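/- arXiv:2411.01810 — 3 statements merged into one kernel-verified Lean document; each statement's English description precedes it below -/
import Mathlib

section
/- Let (N, M, V) be a fair division instance with additive valuations such that every good is positively valued by at least one agent and every agent positively values at least one good. Then there exists an allocation x that is simultaneously EF1 and fractionally Pareto optimal (fPO). -/
open Finset

noncomputable section

/-- Value of a bundle under additive valuations. -/
def val {n m : ℕ} (v : Fin n → Fin m → ℝ) (i : Fin n) (S : Finset (Fin m)) : ℝ :=
  ∑ g ∈ S, v i g

/-- An allocation is a partition of the goods: every good belongs to exactly one bundle. -/
def IsAllocation {n m : ℕ} (x : Fin n → Finset (Fin m)) : Prop :=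
  ∀ g : Fin m, ∃! i : Fin n, g ∈ x i

/-- Envy-freeness up to one good. -/
def EF1 {n m : ℕ} (v : Fin n → Fin m → ℝ) (x : Fin n → Finset (Fin m)) : Prop :=
  ∀ i j : Fin n, val v i (x i) < val v i (x j) →
    ∃ g ∈ x j, val v i ((x j).erase g) ≤ val v i (x i)

/-- A fractional allocation. -/
def IsFracAlloc {n m : ℕ} (y : Fin n → Fin m → ℝ) : Prop :=
  (∀ i g, 0 ≤ y i g ∧ y i g ≤ 1) ∧ ∀ g : Fin m, ∑ i, y i g ≤ 1

/-- Value of agent `i`'s fractional bundle. -/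
def fval {n m : ℕ} (v : Fin n → Fin m → ℝ) (i : Fin n) (y : Fin n → Fin m → ℝ) : ℝ :=
  ∑ g, y i g * v i g

/-- Fractional Pareto optimality. -/
def FPO {n m : ℕ} (v : Fin n → Fin m → ℝ) (x : Fin n → Finset (Fin m)) : Prop :=
  ¬ ∃ y : Fin n → Fin m → ℝ, IsFracAlloc y ∧
      (∀ i, val v i (x i) ≤ fval v i y) ∧ (∃ j, val v j (x j) < fval v j y)

/-- Total price of a bundle. -/
def price {m : ℕ} (p : Fin m → ℝ) (S : Finset (Fin m)) : ℝ := ∑ g ∈ S, p g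

/-- Price of a bundle after removing its most expensive good (`0` for the empty bundle). -/
def phat {m : ℕ} (p : Fin m → ℝ) (S : Finset (Fin m)) : ℝ :=
  if h : S.Nonempty then S.inf' h (fun g => price p (S.erase g)) else 0

/-- Price envy-freeness up to one good. -/
def PEF1 {n m : ℕ} (p : Fin m → ℝ) (x : Fin n → Finset (Fin m)) : Prop :=
  ∀ i j : Fin n, price p (x i) < price p (x j) →
    ∃ g ∈ x j, price p ((x j).erase g) ≤ price p (x i)

/-- The set of maximum bang-per-buck goods of agent `i`. -/
def MBB {n m : ℕ} (v : Fin n → Fin m → ℝ) (p : Fin m → ℝ) (i : Fin n) : Set (Fin m) :=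
  {g | ∀ h : Fin m, v i h / p h ≤ v i g / p g}


section EF1helpers

set_option linter.unusedSectionVars false

variable {A G : Type} [Fintype A] [Fintype G] [DecidableEq A] [DecidableEq G]

/-- Sum of `u` over the bundle of `k`. -/
def bsum (u : G → ℝ) (f : G → A) (k : A) : ℝ := ∑ g, if f g = k then u g else 0

lemma bsum_update (u : G → ℝ) (f : G → A) (g : G) (a k : A) :
    bsum u (Function.update f g a) k
      = bsum u f k + (if a = k then u g else 0) - (if f g = k then u g else 0) := by
  unfold bsum
  rw [← Finset.add_sum_erase _ _ (Finset.mem_univ g),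
    ← Finset.add_sum_erase (a := g) _ (fun g => if f g = k then u g else 0) (Finset.mem_univ g)]
  have : ∑ x ∈ Finset.univ.erase g, (if Function.update f g a x = k then u x else 0)
      = ∑ x ∈ Finset.univ.erase g, (if f x = k then u x else 0) := by
    apply Finset.sum_congr rfl
    intro x hx
    rw [Function.update_of_ne (Finset.ne_of_mem_erase hx)]
  rw [this]
  simp only [Function.update_self]
  ring

lemma bsum_nonneg (u : G → ℝ) (hu : ∀ g, 0 ≤ u g) (f : G → A) (k : A) : 0 ≤ bsum u f k := by
  unfold bsum
  apply Finset.sum_nonneg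
  intro g _
  split_ifs
  · exact hu g
  · exact le_rfl

lemma le_bsum (u : G → ℝ) (hu : ∀ g, 0 ≤ u g) (f : G → A) (g : G) : u g ≤ bsum u f (f g) := by
  unfold bsum
  have := Finset.single_le_sum (f := fun x => if f x = f g then u x else 0) (s := Finset.univ)
    (fun x _ => by
      split_ifs
      · exact hu x
      · exact le_rfl) (Finset.mem_univ g)
  simpa using this

/-- Upper condition: price after removing some good is at most one. -/
def Hat (p : G → ℝ) (f : G → A) (k : A) : Prop :=
  bsum p f k ≤ 1 ∨ ∃ g, f g = k ∧ bsum p f k - p g ≤ 1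

def layer (E : A → G → Prop) (f : G → A) (i : A) : ℕ → Set A
  | 0 => {i}
  | d + 1 => layer E f i d ∪ {b | ∃ a ∈ layer E f i d, ∃ g, E a g ∧ f g = b}

lemma layer_mono (E : A → G → Prop) (f : G → A) (i : A) {d e : ℕ} (h : d ≤ e) :
    layer E f i d ⊆ layer E f i e := by
  induction h with
  | refl => exact subset_rfl
  | step _ ih => exact ih.trans (fun x hx => Or.inl hx)

lemma mem_layer (E : A → G → Prop) (f : G → A) (i : A) {d e : ℕ} (h : d < e) {a : A} {g : G}
    (ha : a ∈ layer E f i d) (hg : E a g) : f g ∈ layer E f i e :=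
  layer_mono E f i h (Or.inr ⟨a, ha, g, hg, rfl⟩)

lemma layer_update (E : A → G → Prop) (f : G → A) (i : A) (D : ℕ) (g : G) (a : A)
    (hu : f g ∉ layer E f i D) :
    ∀ e ≤ D, layer E (Function.update f g a) i e = layer E f i e := by
  intro e
  induction e with
  | zero => intro _; rfl
  | succ e ih =>
    intro he
    have ih := ih (by omega)
    ext b
    simp only [layer, ih]
    constructor
    · rintro (h | ⟨a', ha', g', hg', hb⟩)
      · exact Or.inl h
      · refine Or.inr ⟨a', ha', g', hg', ?_⟩
        have : g' ≠ g := by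
          rintro rfl
          exact hu (mem_layer E f i (by omega) ha' hg')
        rwa [Function.update_of_ne this] at hb
    · rintro (h | ⟨a', ha', g', hg', hb⟩)
      · exact Or.inl h
      · refine Or.inr ⟨a', ha', g', hg', ?_⟩
        have : g' ≠ g := by
          rintro rfl
          exact hu (mem_layer E f i (by omega) ha' hg')
        rwa [Function.update_of_ne this]

/-- The vector counting goods owned within distance `d`. -/
def cvec (E : A → G → Prop) (i : A) (f : G → A) : Lex (ℕ → ℕ) :=
  toLex (fun d => Set.ncard {g | f g ∈ layer E f i d})

lemma cvec_lt (E : A → G → Prop) (f : G → A) (i : A) (D : ℕ) (g : G) (a : A)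
    (ha : a ∈ layer E f i D) (hg : E a g) (hu : f g ∉ layer E f i D) :
    cvec E i f < cvec E i (Function.update f g a) := by
  refine ⟨D, ?_, ?_⟩
  · intro e he
    show Set.ncard _ = Set.ncard _
    congr 1
    ext g'
    simp only [Set.mem_ofPred_eq]
    rw [layer_update E f i D g a hu e he.le]
    by_cases h : g' = g
    · subst h
      rw [Function.update_self]
      constructor
      · intro h; exact absurd (layer_mono E f i he.le h) hu
      · intro h; exact absurd (mem_layer E f i he h hg) hu
    · rw [Function.update_of_ne h]
  · show Set.ncard _ < Set.ncard _
    apply Set.ncard_lt_ncard _ (Set.toFinite _)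
    rw [layer_update E f i D g a hu D le_rfl]
    constructor
    · intro g' hg'
      have : g' ≠ g := by
        rintro rfl
        exact hu hg'
      simpa [Function.update_of_ne this] using hg'
    · intro h
      have : g ∈ {g' | f g' ∈ layer E f i D} := h (by simpa using ha)
      exact hu this

lemma hat_update_ne (p : G → ℝ) (f : G → A) (g : G) (a k : A) (h1 : k ≠ f g) (h2 : k ≠ a)
    (h : Hat p f k) : Hat p (Function.update f g a) k := by
  unfold Hat at *
  rw [bsum_update, if_neg h2.symm, if_neg h1.symm]
  rcases h with h | ⟨x, hx, h⟩
  · left; linarith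
  · right
    refine ⟨x, ?_, by linarith⟩
    rw [Function.update_of_ne]
    · exact hx
    · rintro rfl; exact h1 hx.symm

def Proper (p : G → ℝ) (E : A → G → Prop) (P : Finset A) (f : G → A) : Prop :=
  (∀ g, E (f g) g) ∧ (∀ k ∈ P, 1 ≤ bsum p f k) ∧ ∀ k, Hat p f k

lemma give (p : G → ℝ) (hp : ∀ g, 0 ≤ p g) (E : A → G → Prop) (P : Finset A) (i : A) :
    ∀ (D : ℕ) (f : G → A) (g : G) (a : A), a ∈ layer E f i D → E a g → f g ∉ layer E f i D →
    (∀ g, E (f g) g) → (∀ k ∈ P, 1 ≤ bsum p f k) → 1 ≤ bsum p f (f g) - p g →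
    (∀ k, k ≠ f g → Hat p f k) → Hat p (Function.update f g a) (f g) → bsum p f i ≤ 1 →
    (∀ e < D, ∀ a' ∈ layer E f i e, ∀ g', E a' g' → f g' ∉ layer E f i e →
      bsum p f (f g') - p g' < 1) →
    ∃ f', Proper p E P f' ∧ cvec E i f < cvec E i f' := by
  intro D
  induction D with
  | zero =>
    intro f g a ha hag hu hE hP h1 hhat hhu hi _
    have hai : a = i := ha
    subst hai
    have hne : f g ≠ a := hu
    refine ⟨Function.update f g a, ⟨?_, ?_, ?_⟩, cvec_lt E f a 0 g a ha hag hu⟩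
    · intro x
      by_cases hx : x = g
      · subst hx; simpa using hag
      · rw [Function.update_of_ne hx]; exact hE x
    · intro k hk
      rw [bsum_update]
      have := hP k hk
      have := hp g
      split_ifs with h2 h3 h3
      · linarith
      · linarith
      · subst h3; linarith
      · linarith
    · intro k
      by_cases hk : k = f g
      · rw [hk]; exact hhu
      by_cases hk2 : k = a
      · subst hk2
        right
        refine ⟨g, by simp, ?_⟩
        rw [bsum_update, if_pos rfl, if_neg hne]
        linarith
      · exact hat_update_ne p f g a k hk hk2 (hhat k hk)
  | succ D ih =>
    intro f g a ha hag hu hE hP h1 hhat hhu hi hno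
    have haD : a ∉ layer E f i D := fun h => hu (mem_layer E f i (Nat.lt_succ_self D) h hag)
    have hne : f g ≠ a := fun h => hu (h ▸ ha)
    have hlt := cvec_lt E f i (D + 1) g a ha hag hu
    have hlay := layer_update E f i (D + 1) g a hu
    have hE1 : ∀ x, E (Function.update f g a x) x := by
      intro x
      by_cases hx : x = g
      · subst hx; simpa using hag
      · rw [Function.update_of_ne hx]; exact hE x
    have hP1 : ∀ k ∈ P, 1 ≤ bsum p (Function.update f g a) k := by
      intro k hk
      rw [bsum_update]
      have := hP k hk
      have := hp g
      split_ifs with h2 h3 h3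
      · linarith
      · linarith
      · subst h3; linarith
      · linarith
    have hhat1 : ∀ k, k ≠ a → Hat p (Function.update f g a) k := by
      intro k hk2
      by_cases hk : k = f g
      · rw [hk]; exact hhu
      · exact hat_update_ne p f g a k hk hk2 (hhat k hk)
    by_cases hat : Hat p (Function.update f g a) a
    · refine ⟨_, ⟨hE1, hP1, ?_⟩, hlt⟩
      intro k
      by_cases hk : k = a
      · rw [hk]; exact hat
      · exact hhat1 k hk
    · have ha2 := ha
      rcases ha2 with h | ⟨a', ha', ga, hga, hfa⟩
      · exact absurd h haD
      have hgag : ga ≠ g := by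
        rintro rfl; exact hne hfa
      have hf1 : Function.update f g a ga = a := by
        rw [Function.update_of_ne hgag]; exact hfa
      have ha'a : a' ≠ a := by
        rintro rfl; exact haD ha'
      have hiD : i ∈ layer E f i D := layer_mono E f i (Nat.zero_le D) rfl
      have hia : a ≠ i := by
        rintro rfl; exact haD hiD
      have hiu : f g ≠ i := by
        intro h
        exact hu (layer_mono E f i (Nat.le_succ D) (h ▸ hiD))
      have hb := hno D (Nat.lt_succ_self D) a' ha' ga hga (by rw [hfa]; exact haD)
      rw [hfa] at hb
      obtain ⟨f', hf', hlt'⟩ := ih (Function.update f g a) ga a'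
        (by rw [hlay D (Nat.le_succ D)]; exact ha') hga
        (by rw [hlay D (Nat.le_succ D), hf1]; exact haD) hE1 hP1
        (by
          rw [hf1]
          by_contra hc
          exact hat (Or.inr ⟨ga, hf1, by linarith⟩))
        (by rw [hf1]; exact hhat1)
        (by
          rw [hf1]
          right
          refine ⟨g, ?_, ?_⟩
          · rw [Function.update_of_ne hgag.symm, Function.update_self]
          · rw [bsum_update, bsum_update, if_pos rfl, if_neg hne, if_neg ha'a, hf1, if_pos rfl]
            linarith)
        (by
          rw [bsum_update, if_neg hia, if_neg hiu]; linarith)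
        (by
          intro e he a'' ha'' g' hg' hfg'
          rw [hlay e (by omega)] at ha'' hfg'
          have hgg : g' ≠ g := by
            rintro rfl
            exact hu (mem_layer E f i (by omega) ha'' hg')
          rw [Function.update_of_ne hgg] at hfg' ⊢
          have hin : f g' ∈ layer E f i D := mem_layer E f i he ha'' hg'
          have h3 : a ≠ f g' := by
            intro h; rw [← h] at hin; exact haD hin
          have h4 : f g ≠ f g' := by
            intro h; rw [← h] at hin; exact hu (layer_mono E f i (Nat.le_succ D) hin)
          rw [bsum_update, if_neg h3, if_neg h4]
          have := hno e (by omega) a'' ha'' g' hg' hfg'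
          linarith)
      refine ⟨f', ?_⟩
      exact And.intro hf' (hlt.trans hlt')

/-- Fixed price lemma. -/
lemma fixed_price (p : G → ℝ) (hp : ∀ g, 0 ≤ p g) (E : A → G → Prop) (P : Finset A) (i : A)
    (hex : ∃ f, Proper p E P f) (hi : ∀ f, Proper p E P f → bsum p f i < 1) :
    ∃ f, Proper p E P f ∧ ∀ k, (∃ d, k ∈ layer E f i d) →
      bsum p f k < 1 ∨ ∃ g, f g = k ∧ bsum p f k - p g < 1 := by
  classical
  have : Nonempty {f // Proper p E P f} := ⟨⟨hex.choose, hex.choose_spec⟩⟩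
  obtain ⟨⟨f, hf⟩, hmax⟩ := Finite.exists_max (fun f : {f // Proper p E P f} => cvec E i f.1)
  have hno : ∀ e, ∀ a' ∈ layer E f i e, ∀ g', E a' g' → f g' ∉ layer E f i e →
      bsum p f (f g') - p g' < 1 := by
    intro e
    induction e using Nat.strong_induction_on with
    | _ e ih =>
      intro a ha g hg hu
      by_contra hc
      push Not at hc
      obtain ⟨f', hf', hlt⟩ := give p hp E P i e f g a ha hg hu hf.1 hf.2.1 hc
        (fun k _ => hf.2.2 k)
        (by
          have hne : a ≠ f g := by
            rintro rfl; exact hu ha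
          have h := hf.2.2 (f g)
          unfold Hat at *
          rw [bsum_update, if_neg hne, if_pos rfl]
          have := hp g
          rcases h with h | ⟨x, hx, h⟩
          · left; linarith
          · by_cases hxg : x = g
            · subst hxg; left; linarith
            · right
              exact ⟨x, by rw [Function.update_of_ne hxg]; exact hx, by linarith⟩)
        (hi f hf).le ih
      exact absurd (hmax ⟨f', hf'⟩) (not_le.2 hlt)
  refine ⟨f, hf, ?_⟩
  rintro k ⟨d, hd⟩
  induction d with
  | zero =>
    left
    have : k = i := hd
    rw [this]; exact hi f hf
  | succ d ih =>
    by_cases h : k ∈ layer E f i d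
    · exact ih h
    · rcases hd with hd | ⟨a, ha, g, hg, hk⟩
      · exact absurd hd h
      · right
        refine ⟨g, hk, ?_⟩
        have := hno d a ha g hg (by rw [hk]; exact h)
        rwa [hk] at this

/-- A state: weights and an allocation maximizing weighted welfare, with price bounds. -/
def St (v : A → G → ℝ) (P : Finset A) (w : A → ℝ) (f : G → A) : Prop :=
  (∀ k, 0 < w k) ∧ (∀ g j, w j * v j g ≤ w (f g) * v (f g) g) ∧
  (∀ k ∈ P, 1 ≤ w k * bsum (v k) f k) ∧
  ∀ k, w k * bsum (v k) f k ≤ 1 ∨ ∃ g, f g = k ∧ w k * (bsum (v k) f k - v k g) ≤ 1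

lemma bsum_congr_mul (u p : G → ℝ) (c : ℝ) (f : G → A) (k : A)
    (h : ∀ g, f g = k → p g = c * u g) : bsum p f k = c * bsum u f k := by
  unfold bsum
  rw [Finset.mul_sum]
  apply Finset.sum_congr rfl
  intro g _
  split_ifs with hg
  · exact h g hg
  · simp

lemma st_max (v : A → G → ℝ) (hv : ∀ i g, 0 ≤ v i g) (P : Finset A) (f : G → A) (i : A) (W : ℝ)
    (hW : ∀ w, St v P w f → w i ≤ W) (hex : ∃ w, St v P w f) :
    ∃ w, St v P w f ∧ ∀ w', St v P w' f → w' i ≤ w i := by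
  obtain ⟨w1, h1⟩ := hex
  set lam : ℝ := max 1 (W / w1 i) with hlam
  have hl1 : 1 ≤ lam := le_max_left _ _
  have hlW : W ≤ lam * w1 i := by
    have : W / w1 i ≤ lam := le_max_right _ _
    rwa [div_le_iff₀ (h1.1 i)] at this
  set K : Set (A → ℝ) := {w | (∀ g j, w j * v j g ≤ w (f g) * v (f g) g) ∧
    (∀ k ∈ P, 1 ≤ w k * bsum (v k) f k) ∧
    ∀ k, w k * bsum (v k) f k ≤ 1 ∨ ∃ g, f g = k ∧ w k * (bsum (v k) f k - v k g) ≤ 1} with hK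
  have hKc : IsClosed K := by
    have e : K = (⋂ g, ⋂ j, {w : A → ℝ | w j * v j g ≤ w (f g) * v (f g) g}) ∩
        ((⋂ k ∈ P, {w : A → ℝ | 1 ≤ w k * bsum (v k) f k}) ∩
        ⋂ k, ({w : A → ℝ | w k * bsum (v k) f k ≤ 1} ∪
          ⋃ g, ⋃ (_ : f g = k), {w : A → ℝ | w k * (bsum (v k) f k - v k g) ≤ 1})) := by
      ext w
      simp [hK]
    rw [e]
    refine IsClosed.inter ?_ (IsClosed.inter ?_ ?_)
    · exact isClosed_iInter fun g => isClosed_iInter fun j =>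
        isClosed_le (by fun_prop) (by fun_prop)
    · exact isClosed_iInter fun k => isClosed_iInter fun _ =>
        isClosed_le (by fun_prop) (by fun_prop)
    · refine isClosed_iInter fun k => IsClosed.union (isClosed_le (by fun_prop) (by fun_prop)) ?_
      exact isClosed_iUnion_of_finite fun g => isClosed_iUnion_of_finite fun _ =>
        isClosed_le (by fun_prop) (by fun_prop)
  have hcomp : IsCompact (Set.Icc w1 (fun k => lam * w1 k) ∩ K) := isCompact_Icc.inter_right hKc
  have hne : (Set.Icc w1 (fun k => lam * w1 k) ∩ K).Nonempty := by
    refine ⟨w1, ⟨le_rfl, fun k => ?_⟩, h1.2⟩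
    have := h1.1 k
    show w1 k ≤ lam * w1 k
    nlinarith
  obtain ⟨w, ⟨hwI, hwK⟩, hmax⟩ := hcomp.exists_isMaxOn hne
    (f := fun w : A → ℝ => w i) (by fun_prop)
  refine ⟨w, ⟨fun k => lt_of_lt_of_le (h1.1 k) (hwI.1 k), hwK⟩, ?_⟩
  intro w' hw'
  have key : (fun k => min (max (w' k) (w1 k)) (lam * w1 k)) ∈
      (Set.Icc w1 (fun k => lam * w1 k) ∩ K) := by
    refine ⟨⟨fun k => ?_, fun k => min_le_right _ _⟩, ?_, ?_, ?_⟩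
    · have := h1.1 k
      refine le_min (le_max_right _ _) ?_
      nlinarith
    · intro g j
      have a1 := hw'.2.1 g j
      have a2 := h1.2.1 g j
      have n1 := hv j g
      have n2 := hv (f g) g
      show min (max (w' j) (w1 j)) (lam * w1 j) * v j g
        ≤ min (max (w' (f g)) (w1 (f g))) (lam * w1 (f g)) * v (f g) g
      rw [min_mul_of_nonneg _ _ n1, max_mul_of_nonneg _ _ n1, min_mul_of_nonneg _ _ n2,
        max_mul_of_nonneg _ _ n2]
      apply min_le_min (max_le_max a1 a2)
      rw [mul_assoc, mul_assoc]
      exact mul_le_mul_of_nonneg_left a2 (by linarith)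
    · intro k hk
      have a2 := h1.2.2.1 k hk
      have n := bsum_nonneg (v k) (hv k) f k
      refine a2.trans (mul_le_mul_of_nonneg_right ?_ n)
      have := h1.1 k
      refine le_min (le_max_right _ _) ?_
      nlinarith
    · have aux : ∀ c : ℝ, 0 ≤ c → ∀ k, ∀ c', c' ≤ c →
          (c * bsum (v k) f k ≤ 1 ∨ ∃ g, f g = k ∧ c * (bsum (v k) f k - v k g) ≤ 1) →
          (c' * bsum (v k) f k ≤ 1 ∨ ∃ g, f g = k ∧ c' * (bsum (v k) f k - v k g) ≤ 1) := by
        intro c _ k c' hcc h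
        rcases h with h | ⟨g, hg, h⟩
        · left
          exact (mul_le_mul_of_nonneg_right hcc (bsum_nonneg (v k) (hv k) f k)).trans h
        · right
          refine ⟨g, hg, (mul_le_mul_of_nonneg_right hcc ?_).trans h⟩
          have := le_bsum (v k) (hv k) f g
          rw [hg] at this
          linarith
      intro k
      have p1 := h1.1 k
      have p2 := hw'.1 k
      rcases max_cases (w' k) (w1 k) with ⟨h, _⟩ | ⟨h, _⟩
      · exact aux (w' k) p2.le k _ ((min_le_left _ _).trans h.le) (hw'.2.2.2 k)
      · exact aux (w1 k) p1.le k _ ((min_le_left _ _).trans h.le) (h1.2.2.2 k)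
  have h2 := hmax key
  have h3 : min (max (w' i) (w1 i)) (lam * w1 i) ≤ w i := h2
  refine le_trans (le_min (le_max_left _ _) ?_) h3
  exact (hW w' hw').trans hlW

/-- Either the weight of `i` is bounded, or there is a closed set with singleton bundles. -/
lemma bounded_or (v : A → G → ℝ) (hv : ∀ i g, 0 ≤ v i g) (P : Finset A) (f : G → A) (i : A) :
    (∃ W, ∀ w, St v P w f → w i ≤ W) ∨
    ∃ (T : Set A) (w : A → ℝ), i ∈ T ∧ St v P w f ∧ (∀ k ∈ T, ∀ g, 0 < v k g → f g ∈ T) ∧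
      ∀ g g', f g = f g' → (∃ k ∈ T, 0 < v k g) → (∃ k ∈ T, 0 < v k g') → g = g' := by
  by_cases hb : ∃ W, ∀ w, St v P w f → w i ≤ W
  · exact Or.inl hb
  right
  push Not at hb
  let r : A → A → Prop := fun k l => ∃ g, 0 < v k g ∧ f g = l
  let T : Set A := {k | Relation.ReflTransGen r i k}
  have hlarge : ∀ k ∈ T, ∀ B : ℝ, ∃ W, ∀ w, St v P w f → W < w i → B < w k := by
    intro k hk
    induction hk with
    | refl => exact fun B => ⟨B, fun w _ h => h⟩
    | @tail b c _ hbc ih =>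
      intro B
      obtain ⟨g, hg, hfg⟩ := hbc
      obtain ⟨W, hW⟩ := ih (max 0 B * v c g / v b g)
      refine ⟨W, fun w hw hwi => ?_⟩
      have h1 := hW w hw hwi
      rw [div_lt_iff₀ hg] at h1
      have h2 := hw.2.1 g b
      rw [hfg] at h2
      have h3 : max 0 B * v c g < w c * v c g := lt_of_lt_of_le h1 h2
      have h4 : max 0 B < w c := lt_of_mul_lt_mul_right h3 (hv c g)
      exact (le_max_right _ _).trans_lt h4
  have hchoice : ∀ kg : A × G, ∃ W : ℝ, ∀ w, St v P w f → W < w i → kg.1 ∈ T →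
      0 < v kg.1 kg.2 → 1 < w kg.1 * v kg.1 kg.2 := by
    rintro ⟨k, g⟩
    by_cases hk : k ∈ T
    · by_cases hg : 0 < v k g
      · obtain ⟨W, hW⟩ := hlarge k hk (1 / v k g)
        refine ⟨W, fun w hw hwi _ _ => ?_⟩
        have := hW w hw hwi
        rwa [div_lt_iff₀ hg] at this
      · exact ⟨0, fun _ _ _ _ h => absurd h hg⟩
    · exact ⟨0, fun _ _ _ h => absurd h hk⟩
  choose Wf hWf using hchoice
  obtain ⟨M, hM⟩ := (Set.finite_range Wf).bddAbove
  obtain ⟨w, hw, hwi⟩ := hb M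
  have hbig : ∀ k ∈ T, ∀ g, 0 < v k g → 1 < w (f g) * v (f g) g := by
    intro k hk g hg
    have := hWf (k, g) w hw (lt_of_le_of_lt (hM ⟨(k, g), rfl⟩) hwi) hk hg
    exact this.trans_le (hw.2.1 g k)
  refine ⟨T, w, Relation.ReflTransGen.refl, hw, ?_, ?_⟩
  · intro k hk g hg
    exact Relation.ReflTransGen.tail hk ⟨g, hg, rfl⟩
  · rintro g g' hgg ⟨k, hk, hkg⟩ ⟨k', hk', hkg'⟩
    by_contra hne
    have b1 := hbig k hk g hkg
    have b2 := hbig k' hk' g' hkg'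
    rw [← hgg] at b2
    have hpos := hw.1 (f g)
    have two : ∀ x y : G, x ≠ y → f x = f g → f y = f g →
        v (f g) x + v (f g) y ≤ bsum (v (f g)) f (f g) := by
      intro x y hxy hx hy
      unfold bsum
      have := Finset.sum_le_sum_of_subset_of_nonneg (Finset.subset_univ {x, y})
        (f := fun z => if f z = f g then v (f g) z else 0)
        (fun z _ _ => by
          split_ifs
          · exact hv _ z
          · exact le_rfl)
      rw [Finset.sum_pair hxy] at this
      simpa [hx, hy] using this
    rcases hw.2.2.2 (f g) with h | ⟨x, hx, h⟩
    · have := two g g' hne rfl hgg.symm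
      nlinarith [mul_le_mul_of_nonneg_left this hpos.le]
    · by_cases hxg : x = g
      · have := two g g' hne rfl hgg.symm
        subst hxg
        nlinarith [mul_le_mul_of_nonneg_left this hpos.le]
      · have := two x g hxg hx rfl
        nlinarith [mul_le_mul_of_nonneg_left this hpos.le]

lemma exists_start (v : A → G → ℝ) (hv : ∀ i g, 0 ≤ v i g) [Nonempty A] :
    ∃ w f, St v ∅ w f := by
  have hch : ∀ g, ∃ k, ∀ j, v j g ≤ v k g := fun g => Finite.exists_max (fun j => v j g)
  choose f hf using hch
  set S : ℝ := 1 + ∑ k, bsum (v k) f k with hS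
  have hnn : ∀ k, 0 ≤ bsum (v k) f k := fun k => bsum_nonneg (v k) (hv k) f k
  have hS0 : 0 < S := by
    have := Finset.sum_nonneg (s := Finset.univ) (fun k _ => hnn k)
    linarith
  refine ⟨fun _ => 1 / S, f, fun _ => by positivity, ?_, by simp, ?_⟩
  · intro g j
    exact mul_le_mul_of_nonneg_left (hf g j) (by positivity)
  · intro k
    left
    have := Finset.single_le_sum (fun k _ => hnn k) (Finset.mem_univ k)
    rw [one_div, inv_mul_le_iff₀ hS0]
    linarith

/-- Improvement: with the allocation modified at fixed prices, the weight of `i` can be raised. -/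
lemma improve (v : A → G → ℝ) (hv : ∀ i g, 0 ≤ v i g) (P : Finset A) (i : A)
    (w : A → ℝ) (f0 : G → A) (h0 : St v P w f0)
    (hi : ∀ f, St v P w f → w i * bsum (v i) f i < 1) :
    ∃ w' f, St v P w' f ∧ w i < w' i := by
  classical
  set p : G → ℝ := fun g => w (f0 g) * v (f0 g) g with hp
  set E : A → G → Prop := fun a g => ∀ j, w j * v j g ≤ w a * v a g with hE
  have hpe : ∀ f : G → A, (∀ g, E (f g) g) → ∀ g, p g = w (f g) * v (f g) g := by
    intro f hf g
    exact le_antisymm (hf g _) (h0.2.1 g _)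
  have hbs : ∀ f : G → A, (∀ g, E (f g) g) → ∀ k, bsum p f k = w k * bsum (v k) f k := by
    intro f hf k
    apply bsum_congr_mul
    rintro g rfl
    exact hpe f hf g
  have hiff : ∀ f, Proper p E P f ↔ St v P w f := by
    intro f
    constructor
    · rintro ⟨h1, h2, h3⟩
      refine ⟨h0.1, h1, fun k hk => by rw [← hbs f h1]; exact h2 k hk, fun k => ?_⟩
      have := h3 k
      unfold Hat at this
      rw [hbs f h1] at this
      rcases this with h | ⟨g, hg, h⟩
      · exact Or.inl h
      · right
        refine ⟨g, hg, ?_⟩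
        rw [hpe f h1 g, hg] at h
        linarith
    · rintro ⟨_, h1, h2, h3⟩
      refine ⟨h1, fun k hk => by rw [hbs f h1]; exact h2 k hk, fun k => ?_⟩
      unfold Hat
      rw [hbs f h1]
      rcases h3 k with h | ⟨g, hg, h⟩
      · exact Or.inl h
      · right
        refine ⟨g, hg, ?_⟩
        rw [hpe f h1 g, hg]
        linarith
  obtain ⟨f, hf, hR⟩ := fixed_price p (fun g => mul_nonneg (h0.1 _).le (hv _ _)) E P i
    ⟨f0, (hiff f0).2 h0⟩ (fun f hf => by
      rw [hbs f hf.1]; exact hi f ((hiff f).1 hf))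
  have hst := (hiff f).1 hf
  set R : Set A := {k | ∃ d, k ∈ layer E f i d} with hRdef
  have hiR : i ∈ R := ⟨0, rfl⟩
  have hcl : ∀ a ∈ R, ∀ g, E a g → f g ∈ R := by
    rintro a ⟨d, hd⟩ g hg
    exact ⟨d + 1, mem_layer E f i (Nat.lt_succ_self d) hd hg⟩
  have hlim : ∀ x : ℝ, x < 1 → ∀ᶠ l in nhdsWithin (1 : ℝ) (Set.Ioi 1), l * x ≤ 1 := by
    intro x hx
    have : Filter.Tendsto (fun l : ℝ => l * x) (nhdsWithin (1 : ℝ) (Set.Ioi 1)) (nhds (1 * x)) :=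
      ((continuous_id.mul continuous_const).tendsto 1).mono_left nhdsWithin_le_nhds
    have h := this.eventually (gt_mem_nhds (by linarith : 1 * x < 1))
    exact h.mono (fun _ h => le_of_lt h)
  have ev1 : ∀ᶠ l in nhdsWithin (1 : ℝ) (Set.Ioi 1), ∀ k : A, k ∈ R →
      l * (w k * bsum (v k) f k) ≤ 1 ∨
      ∃ g, f g = k ∧ l * (w k * (bsum (v k) f k - v k g)) ≤ 1 := by
    rw [Filter.eventually_all]
    intro k
    by_cases hk : k ∈ R
    · rcases hR k hk with h | ⟨g, hg, h⟩
      · rw [hbs f hf.1] at h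
        exact (hlim _ h).mono (fun l hl _ => Or.inl hl)
      · rw [hbs f hf.1, hpe f hf.1 g, hg] at h
        have h' : w k * (bsum (v k) f k - v k g) < 1 := by linarith
        exact (hlim _ h').mono (fun l hl _ => Or.inr ⟨g, hg, hl⟩)
    · exact Filter.Eventually.of_forall (fun l h => absurd h hk)
  have ev2 : ∀ᶠ l in nhdsWithin (1 : ℝ) (Set.Ioi 1), ∀ kg : A × G, kg.1 ∈ R → f kg.2 ∉ R →
      l * (w kg.1 * v kg.1 kg.2) ≤ w (f kg.2) * v (f kg.2) kg.2 := by
    rw [Filter.eventually_all]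
    rintro ⟨k, g⟩
    by_cases hk : k ∈ R
    · by_cases hg : f g ∈ R
      · exact Filter.Eventually.of_forall (fun l _ h => absurd hg h)
      · have hlt : w k * v k g < w (f g) * v (f g) g := by
          by_contra hc
          push Not at hc
          exact hg (hcl k hk g (fun j => (hf.1 g j).trans hc))
        have hpos : 0 < w (f g) * v (f g) g :=
          lt_of_le_of_lt (mul_nonneg (h0.1 k).le (hv k g)) hlt
        refine (hlim (w k * v k g / (w (f g) * v (f g) g)) ((div_lt_one hpos).2 hlt)).mono ?_
        intro l hl _ _
        rw [← mul_div_assoc, div_le_one hpos] at hl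
        exact hl
    · exact Filter.Eventually.of_forall (fun l h => absurd h hk)
  obtain ⟨l, ⟨hl1, hl2⟩, hl⟩ := ((ev1.and ev2).and self_mem_nhdsWithin).exists
  have hl : 1 < l := hl
  have hge : ∀ k, w k ≤ (if k ∈ R then l * w k else w k) := by
    intro k
    have := h0.1 k
    split_ifs
    · nlinarith
    · exact le_rfl
  refine ⟨fun k => if k ∈ R then l * w k else w k, f, ⟨?_, ?_, ?_, ?_⟩, ?_⟩
  · intro k
    exact (h0.1 k).trans_le (hge k)
  · intro g j
    have h1 := hf.1 g j
    have hn := mul_nonneg (h0.1 j).le (hv j g)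
    show (if j ∈ R then l * w j else w j) * v j g
      ≤ (if f g ∈ R then l * w (f g) else w (f g)) * v (f g) g
    by_cases hg : f g ∈ R
    · rw [if_pos hg]
      split_ifs
      · rw [mul_assoc, mul_assoc]
        exact mul_le_mul_of_nonneg_left h1 (by linarith)
      · rw [mul_assoc]
        nlinarith
    · rw [if_neg hg]
      split_ifs with hj
      · rw [mul_assoc]
        exact hl2 (j, g) hj hg
      · exact h1
  · intro k hk
    exact (hst.2.2.1 k hk).trans
      (mul_le_mul_of_nonneg_right (hge k) (bsum_nonneg (v k) (hv k) f k))
  · intro k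
    by_cases hk : k ∈ R
    · simp only [if_pos hk, mul_assoc]
      exact hl1 k hk
    · simp only [if_neg hk]
      exact hst.2.2.2 k
  · have := h0.1 i
    simp only [if_pos hiR]
    nlinarith

/-- Either all agents reach spending one, or there is a closed set with singleton bundles. -/
lemma core (v : A → G → ℝ) (hv : ∀ i g, 0 ≤ v i g) [Nonempty A] :
    (∃ w f, St v Finset.univ w f) ∨
    ∃ (T : Set A) (w : A → ℝ) (f : G → A) (P : Finset A), T.Nonempty ∧ St v P w f ∧
      (∀ k ∈ T, ∀ g, 0 < v k g → f g ∈ T) ∧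
      ∀ g g', f g = f g' → (∃ k ∈ T, 0 < v k g) → (∃ k ∈ T, 0 < v k g') → g = g' := by
  classical
  obtain ⟨P, hPmem, hPmax⟩ := Finset.exists_max_image
    (Finset.univ.filter (fun P : Finset A => ∃ w f, St v P w f)) Finset.card
    ⟨∅, by simpa using exists_start v hv⟩
  simp only [Finset.mem_filter, Finset.mem_univ, true_and] at hPmem hPmax
  by_cases hall : P = Finset.univ
  · left; rw [← hall]; exact hPmem
  right
  obtain ⟨i, hi⟩ : ∃ i, i ∉ P := by
    by_contra hc
    push Not at hc
    exact hall (Finset.eq_univ_iff_forall.2 hc)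
  by_contra hno
  have hlt : ∀ w f, St v P w f → w i * bsum (v i) f i < 1 := by
    intro w f hst
    by_contra hc
    push Not at hc
    have := hPmax (insert i P) ⟨w, f, hst.1, hst.2.1, fun k hk => by
      rcases Finset.mem_insert.1 hk with rfl | hk
      · exact hc
      · exact hst.2.2.1 k hk, hst.2.2.2⟩
    rw [Finset.card_insert_of_notMem hi] at this
    omega
  have hmaxf : ∀ f : {f : G → A // ∃ w, St v P w f},
      ∃ w, St v P w f.1 ∧ ∀ w', St v P w' f.1 → w' i ≤ w i := by
    rintro ⟨f, hf⟩
    rcases bounded_or v hv P f i with ⟨W, hW⟩ | ⟨T, w, hiT, h1, h2, h3⟩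
    · exact st_max v hv P f i W hW hf
    · exact absurd ⟨T, w, f, P, ⟨i, hiT⟩, h1, h2, h3⟩ hno
  choose wf hwf hwmax using hmaxf
  obtain ⟨w0, f0, h00⟩ := hPmem
  have : Nonempty {f : G → A // ∃ w, St v P w f} := ⟨⟨f0, w0, h00⟩⟩
  obtain ⟨f, hfmax⟩ := Finite.exists_max (fun f : {f : G → A // ∃ w, St v P w f} => wf f i)
  obtain ⟨w', f', hst', hgt⟩ := improve v hv P i (wf f) f.1 (hwf f) (fun f'' h => hlt _ f'' h)
  have h1 := hwmax ⟨f', w', hst'⟩ w' hst'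
  have h2 := hfmax ⟨f', w', hst'⟩
  linarith

/-- The target property in terms of an ownership function. -/
def Good (v : A → G → ℝ) : Prop :=
  ∃ (w : A → ℝ) (f : G → A), (∀ k, 0 < w k) ∧ (∀ g j, w j * v j g ≤ w (f g) * v (f g) g) ∧
    ∀ i k, bsum (v i) f k ≤ bsum (v i) f i ∨
      ∃ h, f h = k ∧ bsum (v i) f k - v i h ≤ bsum (v i) f i

lemma good_of_st (v : A → G → ℝ) (w : A → ℝ) (f : G → A)
    (h : St v Finset.univ w f) : Good v := by
  refine ⟨w, f, h.1, h.2.1, ?_⟩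
  intro i k
  have hi := h.2.2.1 i (Finset.mem_univ i)
  have hpos := h.1 i
  rcases h.2.2.2 k with hk | ⟨x, hx, hk⟩
  · left
    have h1 : w i * bsum (v i) f k ≤ w k * bsum (v k) f k := by
      unfold bsum
      rw [Finset.mul_sum, Finset.mul_sum]
      apply Finset.sum_le_sum
      intro g _
      split_ifs with hg
      · have := h.2.1 g i
        rwa [hg] at this
      · simp
    have h2 : w i * bsum (v i) f k ≤ w i * bsum (v i) f i := by linarith
    exact le_of_mul_le_mul_left h2 hpos
  · right
    refine ⟨x, hx, ?_⟩
    have e : ∀ j, bsum (v j) f k - v j x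
        = ∑ g ∈ Finset.univ.erase x, if f g = k then v j g else 0 := by
      intro j
      unfold bsum
      rw [← Finset.add_sum_erase _ _ (Finset.mem_univ x), if_pos hx]
      ring
    have h1 : w i * (bsum (v i) f k - v i x) ≤ w k * (bsum (v k) f k - v k x) := by
      rw [e, e, Finset.mul_sum, Finset.mul_sum]
      apply Finset.sum_le_sum
      intro g _
      split_ifs with hg
      · have := h.2.1 g i
        rwa [hg] at this
      · simp
    have h2 : w i * (bsum (v i) f k - v i x) ≤ w i * bsum (v i) f i := by linarith
    exact le_of_mul_le_mul_left h2 hpos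

end EF1helpers

lemma good_all : ∀ (N : ℕ) (A G : Type) [Fintype A] [Fintype G] [DecidableEq A] [DecidableEq G]
    (v : A → G → ℝ), Fintype.card A = N → (∀ i g, 0 ≤ v i g) → (∀ g, ∃ i, 0 < v i g) →
    Good v := by
  classical
  intro N
  induction N using Nat.strong_induction_on with
  | _ N ih =>
  intro A G _ _ _ _ v hN hv hgood
  rcases isEmpty_or_nonempty A with hA | hA
  · refine ⟨fun _ => 1, fun g => (hgood g).choose, ?_, ?_, ?_⟩
    · exact fun k => (hA.false k).elim
    · exact fun _ k => (hA.false k).elim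
    · exact fun k => (hA.false k).elim
  rcases core v hv with ⟨w, f, h⟩ | ⟨T, w, f, P, hT, hst, hcl, hone⟩
  · exact good_of_st v w f h
  let A' := {a : A // a ∉ T}
  let G' := {g : G // ∀ k ∈ T, v k g = 0}
  have hcard : Fintype.card A' < N := by
    rw [← hN]
    obtain ⟨t, ht⟩ := hT
    exact Fintype.card_subtype_lt (x := t) (by simpa using ht)
  obtain ⟨w', f', hw', hm', he'⟩ := ih _ hcard A' G' (fun a g => v a.1 g.1) rfl
    (fun a g => hv _ _) (by
      rintro ⟨g, hg⟩
      obtain ⟨i, hi⟩ := hgood g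
      exact ⟨⟨i, fun hiT => by rw [hg i hiT] at hi; exact lt_irrefl _ hi⟩, hi⟩)
  have hval : ∀ g, ¬ (∀ k ∈ T, v k g = 0) → ∃ k ∈ T, 0 < v k g := by
    intro g hg
    push Not at hg
    obtain ⟨k, hk, hne⟩ := hg
    exact ⟨k, hk, lt_of_le_of_ne (hv k g) hne.symm⟩
  have hfT : ∀ g, ¬ (∀ k ∈ T, v k g = 0) → f g ∈ T := by
    intro g hg
    obtain ⟨k, hk, h⟩ := hval g hg
    exact hcl k hk g h
  have hppos : ∀ g, 0 < w (f g) * v (f g) g := by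
    intro g
    obtain ⟨j, hj⟩ := hgood g
    exact (mul_pos (hst.1 j) hj).trans_le (hst.2.1 g j)
  obtain ⟨M, hM⟩ := (Set.finite_range
    (fun x : A' × G => w' x.1 * v x.1.1 x.2 / (w (f x.2) * v (f x.2) x.2))).bddAbove
  set L : ℝ := max 1 M with hL
  have hL1 : 1 ≤ L := le_max_left _ _
  have hLs : ∀ (a : A') (g : G), w' a * v a.1 g ≤ L * (w (f g) * v (f g) g) := by
    intro a g
    have h1 : w' a * v a.1 g / (w (f g) * v (f g) g) ≤ M := hM ⟨(a, g), rfl⟩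
    have h2 := h1.trans (le_max_right 1 M)
    rwa [div_le_iff₀ (hppos g)] at h2
  let F : G → A := fun g => if h : ∀ k ∈ T, v k g = 0 then (f' ⟨g, h⟩).1 else f g
  let Wt : A → ℝ := fun a => if h : a ∈ T then L * w a else w' ⟨a, h⟩
  have hF1 : ∀ g (h : ∀ k ∈ T, v k g = 0), F g = (f' ⟨g, h⟩).1 := fun g h => dif_pos h
  have hF2 : ∀ g, ¬ (∀ k ∈ T, v k g = 0) → F g = f g := fun g h => dif_neg h
  have hW1 : ∀ a, a ∈ T → Wt a = L * w a := fun a h => dif_pos h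
  have hW2 : ∀ a (h : a ∉ T), Wt a = w' ⟨a, h⟩ := fun a h => dif_neg h
  have hbs : ∀ (u : G → ℝ) (k : A) (hk : k ∉ T),
      bsum u F k = bsum (fun g : G' => u g.1) f' ⟨k, hk⟩ := by
    intro u k hk
    unfold bsum
    rw [← Fintype.sum_subtype_add_sum_subtype (fun g => ∀ k ∈ T, v k g = 0)
      (fun g => if F g = k then u g else 0)]
    have z : ∑ x : {x // ¬ ∀ k ∈ T, v k x = 0}, (if F x.1 = k then u x.1 else 0) = 0 := by
      apply Finset.sum_eq_zero
      rintro ⟨g, hg⟩ _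
      rw [if_neg]
      rw [hF2 g hg]
      intro h
      exact hk (h ▸ hfT g hg)
    rw [z, add_zero]
    apply Finset.sum_congr rfl
    rintro ⟨g, hg⟩ _
    simp only [hF1 g hg]
    congr 1
    exact propext ⟨fun h => Subtype.ext h, fun h => congrArg Subtype.val h⟩
  refine ⟨Wt, F, ?_, ?_, ?_⟩
  · intro k
    by_cases hk : k ∈ T
    · rw [hW1 k hk]
      exact mul_pos (by linarith) (hst.1 k)
    · rw [hW2 k hk]; exact hw' _
  · intro g j
    by_cases hg : ∀ k ∈ T, v k g = 0
    · rw [hF1 g hg, hW2 _ (f' ⟨g, hg⟩).2]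
      by_cases hj : j ∈ T
      · rw [hg j hj, mul_zero]
        exact mul_nonneg (hw' _).le (hv _ _)
      · rw [hW2 j hj]
        exact hm' ⟨g, hg⟩ ⟨j, hj⟩
    · rw [hF2 g hg, hW1 _ (hfT g hg), mul_assoc]
      by_cases hj : j ∈ T
      · rw [hW1 j hj, mul_assoc]
        exact mul_le_mul_of_nonneg_left (hst.2.1 g j) (by linarith)
      · rw [hW2 j hj]
        exact hLs ⟨j, hj⟩ g
  · intro i k
    by_cases hk : k ∈ T
    · by_cases hex : ∃ h, F h = k
      · obtain ⟨h, hh⟩ := hex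
        right
        refine ⟨h, hh, ?_⟩
        have hin : ∀ g, F g = k → ¬ (∀ k ∈ T, v k g = 0) := by
          intro g hg hz
          rw [hF1 g hz] at hg
          exact (f' ⟨g, hz⟩).2 (hg ▸ hk)
        have : bsum (v i) F k = v i h := by
          unfold bsum
          rw [Finset.sum_eq_single h]
          · rw [if_pos hh]
          · intro g _ hne
            rw [if_neg]
            intro hg
            apply hne
            refine hone g h ?_ (hval g (hin g hg)) (hval h (hin h hh))
            rw [← hF2 g (hin g hg), ← hF2 h (hin h hh), hg, hh]
          · intro h; exact absurd (Finset.mem_univ _) h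
        rw [this, sub_self]
        exact bsum_nonneg _ (hv i) F i
      · left
        have : bsum (v i) F k = 0 := by
          unfold bsum
          apply Finset.sum_eq_zero
          intro g _
          rw [if_neg]
          intro hg
          exact hex ⟨g, hg⟩
        rw [this]
        exact bsum_nonneg _ (hv i) F i
    · by_cases hi : i ∈ T
      · left
        rw [hbs _ k hk]
        have : bsum (fun g : G' => v i g.1) f' ⟨k, hk⟩ = 0 := by
          unfold bsum
          apply Finset.sum_eq_zero
          rintro ⟨g, hg⟩ _
          simp [hg i hi]
        rw [this]
        exact bsum_nonneg _ (hv i) F i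
      · rw [hbs _ k hk, hbs _ i hi]
        rcases he' ⟨i, hi⟩ ⟨k, hk⟩ with h | ⟨x, hx, h⟩
        · exact Or.inl h
        · right
          refine ⟨x.1, ?_, h⟩
          rw [hF1 x.1 x.2]
          exact congrArg Subtype.val hx

/-- In every fair division instance with additive valuations where each good
is positively valued by some agent and each agent positively values some good, there
exists an allocation that is both EF1 and fractionally Pareto optimal. -/
theorem ef1_fpo_exists {n m : ℕ} (hn : 1 ≤ n) (v : Fin n → Fin m → ℝ)
    (hv : ∀ i g, 0 ≤ v i g)
    (hgood : ∀ g : Fin m, ∃ i : Fin n, 0 < v i g)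
    (hagent : ∀ i : Fin n, ∃ g : Fin m, 0 < v i g) :
    ∃ x : Fin n → Finset (Fin m), IsAllocation x ∧ EF1 v x ∧ FPO v x := by
  obtain ⟨w, f, hw, hm, he⟩ := good_all n (Fin n) (Fin m) v (Fintype.card_fin n) hv hgood
  have hval : ∀ i k, val v i (Finset.univ.filter (fun g => f g = k)) = bsum (v i) f k := by
    intro i k
    unfold _root_.val bsum
    rw [Finset.sum_filter]
  refine ⟨fun k => Finset.univ.filter (fun g => f g = k), ?_, ?_, ?_⟩
  · intro g
    refine ⟨f g, by simp, ?_⟩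
    intro k hk
    simpa using (Finset.mem_filter.1 hk).2.symm
  · intro i k hlt
    rw [hval, hval] at hlt
    rcases he i k with h | ⟨x, hx, h⟩
    · exact absurd h (not_le.2 hlt)
    · have hmem : x ∈ Finset.univ.filter (fun g => f g = k) := by simpa using hx
      refine ⟨x, hmem, ?_⟩
      rw [hval]
      have e : val v i ((Finset.univ.filter (fun g => f g = k)).erase x)
          = bsum (v i) f k - v i x := by
        rw [← hval]
        unfold _root_.val
        rw [← Finset.add_sum_erase _ _ hmem]
        ring
      rw [e]
      exact h
  · rintro ⟨y, ⟨hy1, hy2⟩, hall, j, hj⟩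
    simp only [hval] at hall hj
    have hlt : ∑ i, w i * bsum (v i) f i < ∑ i, w i * fval v i y := by
      apply Finset.sum_lt_sum
      · intro i _
        exact mul_le_mul_of_nonneg_left (hall i) (hw i).le
      · exact ⟨j, Finset.mem_univ j, mul_lt_mul_of_pos_left hj (hw j)⟩
    have h1 : ∑ i, w i * fval v i y ≤ ∑ g, w (f g) * v (f g) g := by
      unfold fval
      simp only [Finset.mul_sum]
      rw [Finset.sum_comm]
      apply Finset.sum_le_sum
      intro g _
      have h2 : ∑ i, w i * (y i g * v i g) ≤ ∑ i, y i g * (w (f g) * v (f g) g) := by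
        apply Finset.sum_le_sum
        intro i _
        have := mul_le_mul_of_nonneg_left (hm g i) (hy1 i g).1
        linarith
      rw [← Finset.sum_mul] at h2
      have h3 : (∑ i, y i g) * (w (f g) * v (f g) g) ≤ 1 * (w (f g) * v (f g) g) :=
        mul_le_mul_of_nonneg_right (hy2 g) (mul_nonneg (hw _).le (hv _ _))
      linarith
    have h4 : ∑ i, w i * bsum (v i) f i = ∑ g, w (f g) * v (f g) g := by
      unfold bsum
      simp only [Finset.mul_sum]
      rw [Finset.sum_comm]
      apply Finset.sum_congr rfl
      intro g _
      rw [Finset.sum_eq_single (f g)]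
      · rw [if_pos rfl]
      · intro i _ hne
        rw [if_neg hne.symm, mul_zero]
      · intro h
        exact absurd (Finset.mem_univ _) h
    linarith
end
end

section
/- Let (N, M, V) be a fair division instance with additive valuations such that every good is positively valued by at least one agent and every agent positively values at least one good. Then there exists an allocation x that is EF1, fractionally Pareto optimal, and satisfies Π_{i∈N} v_i(x_i) ≥ e^{-n/e} · Π_{i∈N} v_i(y_i) for every allocation y; that is, x is an e^{1/e}-approximation to the maximum Nash social welfare. -/
open Finset

noncomputable section

/-- Spending of agent `a`: a private amount plus the prices of the goods it holds. -/
def spend {n m : ℕ} (c : Fin n → ℝ) (p : Fin m → ℝ) (x : Fin m → Fin n) (a : Fin n) : ℝ :=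
  c a + ∑ g, if x g = a then p g else 0

theorem spend_update {n m : ℕ} (c : Fin n → ℝ) (p : Fin m → ℝ) (x : Fin m → Fin n)
    (g : Fin m) (b a : Fin n) :
    spend c p (Function.update x g b) a = spend c p x a + (if b = a then p g else 0)
      - (if x g = a then p g else 0) := by
  have h : (∑ g', if Function.update x g b g' = a then p g' else 0) -
      (∑ g', if x g' = a then p g' else 0)
      = (if b = a then p g else 0) - (if x g = a then p g else 0) := by
    rw [← Finset.sum_sub_distrib, Finset.sum_eq_single g]
    · simp
    · intro g' _ hg'
      simp [Function.update_of_ne hg']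
    · simp
  unfold spend
  linarith

/-- Spending of `a` up to one good is at most `β`. -/
def UpOne {n m : ℕ} (c : Fin n → ℝ) (p : Fin m → ℝ) (x : Fin m → Fin n) (β : ℝ) (a : Fin n) :
    Prop :=
  spend c p x a ≤ β ∨ ∃ g, x g = a ∧ spend c p x a - p g ≤ β

/-- Feasible states for fixed prices. -/
def Feas {n m : ℕ} (c : Fin n → ℝ) (p : Fin m → ℝ) (E : Fin n → Fin m → Prop) (t β : ℝ)
    (x : Fin m → Fin n) : Prop :=
  (∀ g, E (x g) g) ∧ (∀ a, t ≤ spend c p x a) ∧ ∀ a, UpOne c p x β a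

/-- The chain of transfers. -/
theorem chain {n m : ℕ} (c : Fin n → ℝ) (p : Fin m → ℝ) (hp : ∀ g, 0 ≤ p g)
    (E : Fin n → Fin m → Prop) (t β : ℝ) (htβ : t ≤ β)
    (x : Fin m → Fin n) (hx : Feas c p E t β x) (d : Fin n → ℕ) (D : ℕ)
    (tight : ∀ k, d k < D → ¬ spend c p x k ≤ t →
      ∃ b g, x g = k ∧ E b g ∧ d k = d b + 1 ∧ spend c p x k - p g ≤ t) :
    ∀ (j : ℕ) (x1 : Fin m → Fin n) (k : Fin n) (g : Fin m),
      d k = j → d k < D → x1 g = k → d k < d (x g) →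
      (∀ g', E (x1 g') g') → (∀ g', d (x1 g') ≤ d (x g')) →
      (∀ g', g' ≠ g → d (x g') ≤ d k → x1 g' = x g') →
      (∀ a, d a ≤ d k → spend c p x1 a = spend c p x a + if a = k then p g else 0) →
      (∀ a, a ≠ k → t ≤ spend c p x1 a ∧ (spend c p x1 a ≤ t → spend c p x a ≤ t) ∧
        UpOne c p x1 β a) →
      ∃ x', Feas c p E t β x' ∧ (∀ g', d (x' g') ≤ d (x g')) ∧ (∃ g', d (x' g') < d (x g')) ∧
        ∀ a, spend c p x' a ≤ t → spend c p x a ≤ t := by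
  intro j
  induction j using Nat.strong_induction_on with
  | _ j ih =>
  intro x1 k g hj hkD hgk hgd hE hle hI1 hI2 hoth
  have hsk : spend c p x1 k = spend c p x k + p g := by simpa using hI2 k le_rfl
  have hxk := hx.2.1 k
  have hpg := hp g
  -- stopping criterion
  have finish_here : UpOne c p x1 β k → ∃ x', Feas c p E t β x' ∧ (∀ g', d (x' g') ≤ d (x g')) ∧
      (∃ g', d (x' g') < d (x g')) ∧ ∀ a, spend c p x' a ≤ t → spend c p x a ≤ t := by
    intro hup
    refine ⟨x1, ⟨hE, fun a => ?_, fun a => ?_⟩, hle, ⟨g, by rw [hgk]; exact hgd⟩, fun a ha => ?_⟩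
    · by_cases h : a = k
      · subst h; linarith
      · exact (hoth a h).1
    · by_cases h : a = k
      · subst h; exact hup
      · exact (hoth a h).2.2
    · by_cases h : a = k
      · subst h; linarith
      · exact (hoth a h).2.1 ha
  by_cases hL : spend c p x k ≤ t
  · exact finish_here (Or.inr ⟨g, hgk, by linarith⟩)
  obtain ⟨b, g', hg'k, hbg', hdb, hviol⟩ := tight k hkD hL
  have hgg' : g' ≠ g := by
    rintro rfl
    rw [hg'k] at hgd; omega
  have hx1g' : x1 g' = k := by rw [hI1 g' hgg' (by rw [hg'k])]; exact hg'k
  by_cases hst : spend c p x1 k - p g' ≤ t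
  · exact finish_here (Or.inr ⟨g', hx1g', by linarith⟩)
  have hbk : b ≠ k := by rintro rfl; omega
  have hup := spend_update c p x1 g' b
  have hs2k : spend c p (Function.update x1 g' b) k = spend c p x1 k - p g' := by
    rw [hup]; simp [hbk, hx1g']
  refine ih (d b) (by omega) (Function.update x1 g' b) b g' rfl (by omega) (by simp)
    (by rw [hg'k]; omega) ?_ ?_ ?_ ?_ ?_
  · intro g2
    by_cases h : g2 = g'
    · subst h; simpa using hbg'
    · rw [Function.update_of_ne h]; exact hE g2
  · intro g2
    by_cases h : g2 = g'
    · subst h; simp [hg'k]; omega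
    · rw [Function.update_of_ne h]; exact hle g2
  · intro g2 h2 hd2
    rw [Function.update_of_ne h2]
    refine hI1 g2 ?_ (by omega)
    rintro rfl
    omega
  · intro a ha
    have hak : a ≠ k := by rintro rfl; omega
    rw [hup, hI2 a (by omega)]
    simp [hak, hx1g', Ne.symm hak, eq_comm]
  · intro a hab
    by_cases h : a = k
    · subst h
      rw [hs2k]
      refine ⟨by linarith, fun h => absurd h hst, Or.inr ⟨g, ?_, ?_⟩⟩
      · rw [Function.update_of_ne hgg'.symm]; exact hgk
      · rw [hs2k]; linarith
    · have hs : spend c p (Function.update x1 g' b) a = spend c p x1 a := by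
        rw [hup]; simp [hab.symm, hx1g', Ne.symm h]
      unfold UpOne
      rw [hs]
      obtain ⟨h1, h2, h3⟩ := hoth a h
      refine ⟨h1, h2, ?_⟩
      rcases h3 with h3 | ⟨g2, h3, h4⟩
      · exact Or.inl h3
      · refine Or.inr ⟨g2, ?_, h4⟩
        rw [Function.update_of_ne]
        · exact h3
        · rintro rfl; exact h (h3.symm.trans hx1g')

/-- For fixed prices, one can reach a state with a closed set `C` of agents containing all least
spenders, without violators. -/
theorem discrete {n m : ℕ} (c : Fin n → ℝ) (p : Fin m → ℝ) (hp : ∀ g, 0 ≤ p g)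
    (E : Fin n → Fin m → Prop) (t β : ℝ) (htβ : t ≤ β)
    (x0 : Fin m → Fin n) (hx0 : Feas c p E t β x0) :
    ∃ (x : Fin m → Fin n) (C : Set (Fin n)), Feas c p E t β x ∧
      (∀ a, a ∉ C → t < spend c p x a) ∧ (∀ a ∈ C, UpOne c p x t a) ∧
      (∀ b ∈ C, ∀ g, E b g → x g ∈ C) := by
  classical
  let S : Set ((Fin m → Fin n) × (Fin n → ℕ)) := {z | Feas c p E t β z.1 ∧ (∀ a, z.2 a ≤ n) ∧
    (∀ a, spend c p z.1 a ≤ t → z.2 a = 0) ∧ ∀ b g, E b g → z.2 (z.1 g) ≤ z.2 b + 1}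
  let μ : ((Fin m → Fin n) × (Fin n → ℕ)) → ℕ := fun z =>
    ∑ g, z.2 (z.1 g) + (m + 1) * ∑ a, (n - z.2 a)
  have hS : S.Nonempty := ⟨(x0, fun _ => 0), hx0, by simp, by simp, by simp⟩
  obtain ⟨⟨x, d⟩, ⟨hF, hdn, hd0, hdE⟩, hmin⟩ :=
    (InvImage.wf μ Nat.lt_wfRel.wf).has_min S hS
  simp only at hF hdn hd0 hdE
  have tight : ∀ k, d k < n → ¬ spend c p x k ≤ t →
      ∃ b g, x g = k ∧ E b g ∧ d k = d b + 1 := by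
    intro k hk hL
    by_contra hcon
    push Not at hcon
    refine hmin (x, Function.update d k (d k + 1)) ⟨hF, ?_, ?_, ?_⟩ ?_
    · intro a
      by_cases h : a = k
      · subst h; simpa using hk
      · simpa [Function.update_of_ne h] using hdn a
    · intro a ha
      have h : a ≠ k := by rintro rfl; exact hL ha
      simpa [Function.update_of_ne h] using hd0 a ha
    · intro b g hbg
      have h1 := hdE b g hbg
      have h2 := hcon b g
      simp only [Function.update_apply]
      by_cases h : x g = k
      · have h3 := h2 h hbg
        rw [h] at h1
        simp only [h, if_true]
        split_ifs with h4
        · omega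
        · omega
      · simp only [h, if_false]
        split_ifs with h4
        · subst h4; omega
        · omega
    · show μ _ < μ _
      simp only [μ]
      have e1 : ∑ g, Function.update d k (d k + 1) (x g) ≤ ∑ g, d (x g) + m := by
        calc _ ≤ ∑ g, (d (x g) + 1) := Finset.sum_le_sum (fun g _ => by
              simp only [Function.update_apply]; split_ifs with h
              · rw [h]
              · omega)
          _ = _ := by rw [Finset.sum_add_distrib]; simp
      have e2 : ∑ a, (n - Function.update d k (d k + 1) a) < ∑ a, (n - d a) := by
        refine Finset.sum_lt_sum (fun a _ => ?_) ⟨k, mem_univ _, ?_⟩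
        · simp only [Function.update_apply]; split_ifs with h
          · subst h; omega
          · omega
        · simp; omega
      nlinarith
  have noviol : ∀ j k, d k = j → d k < n → ¬ spend c p x k ≤ t → ∀ b g, x g = k → E b g →
      d k = d b + 1 → spend c p x k - p g ≤ t := by
    intro j
    induction j using Nat.strong_induction_on with
    | _ j ih =>
    intro h hj hhn hL b g hxg hbg hdb
    by_contra hviol
    have hbh : b ≠ h := by rintro rfl; omega
    have hup := spend_update c p x g b
    obtain ⟨x', hF', hle, ⟨g1, hlt⟩, hL'⟩ := chain c p hp E t β htβ x hF d (d h)
      (by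
        intro k hk hkL
        obtain ⟨b', g', h1, h2, h3⟩ := tight k (by omega) hkL
        exact ⟨b', g', h1, h2, h3, ih (d k) (by omega) k rfl (by omega) hkL b' g' h1 h2 h3⟩)
      (d b) (Function.update x g b) b g rfl (by omega) (by simp) (by rw [hxg]; omega)
      (by
        intro g2
        by_cases h2 : g2 = g
        · subst h2; simpa using hbg
        · rw [Function.update_of_ne h2]; exact hF.1 g2)
      (by
        intro g2
        by_cases h2 : g2 = g
        · subst h2; simp [hxg]; omega
        · rw [Function.update_of_ne h2])
      (by intro g2 h2 _; rw [Function.update_of_ne h2])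
      (by
        intro a ha
        have hah : h ≠ a := by rintro rfl; omega
        rw [hup]; simp [hxg, hah, eq_comm])
      (by
        intro a hab
        unfold UpOne
        rw [hup]
        by_cases h2 : a = h
        · subst h2
          simp only [hbh, hxg, if_true, if_false, add_zero]
          refine ⟨by linarith, fun h => absurd h hviol, ?_⟩
          have := hp g
          rcases hF.2.2 a with h3 | ⟨g2, h3, h4⟩
          · left; linarith
          · by_cases h5 : g2 = g
            · subst h5; left; exact h4
            · right; refine ⟨g2, ?_, by linarith⟩
              rw [Function.update_of_ne h5]; exact h3
        · simp only [hab.symm, hxg, Ne.symm h2, if_false, add_zero, sub_zero]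
          refine ⟨hF.2.1 a, id, ?_⟩
          rcases hF.2.2 a with h3 | ⟨g2, h3, h4⟩
          · left; exact h3
          · right; refine ⟨g2, ?_, h4⟩
            rw [Function.update_of_ne]
            · exact h3
            · rintro rfl; exact h2 (h3.symm.trans hxg))
    refine hmin (x', d) ⟨hF', hdn, fun a ha => hd0 a (hL' a ha), fun b g hbg => ?_⟩ ?_
    · exact (hle g).trans (hdE b g hbg)
    · show μ _ < μ _
      simp only [μ]
      have : ∑ g, d (x' g) < ∑ g, d (x g) :=
        Finset.sum_lt_sum (fun g _ => hle g) ⟨g1, mem_univ _, hlt⟩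
      omega
  refine ⟨x, {a | d a < n}, hF, ?_, ?_, ?_⟩
  · intro a ha
    by_contra hcon
    have h1 := hd0 a (not_lt.mp hcon)
    have h2 := a.2
    simp only [Set.mem_ofPred_eq] at ha
    omega
  · intro a ha
    by_cases hL : spend c p x a ≤ t
    · exact Or.inl hL
    · obtain ⟨b, g, h1, h2, h3⟩ := tight a ha hL
      exact Or.inr ⟨g, h1, noviol (d a) a rfl ha hL b g h1 h2 h3⟩
  · intro b hb g hbg
    simp only [Set.mem_ofPred_eq] at hb ⊢
    by_contra hcon
    have h1 := hdE b g hbg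
    have h2 := hdn (x g)
    have h3 : d (x g) = n := by omega
    -- all levels are attained
    have lev : ∀ i, i ≤ d b → ∃ a, d a = d b - i := by
      intro i
      induction i with
      | zero => intro _; exact ⟨b, rfl⟩
      | succ i ih =>
        intro hi
        obtain ⟨a, ha⟩ := ih (by omega)
        have hL : ¬ spend c p x a ≤ t := by
          intro h; have := hd0 a h; omega
        obtain ⟨b', g', h1, h2, h3⟩ := tight a (by omega) hL
        exact ⟨b', by omega⟩
    have hsub : Finset.range (n + 1) ⊆ Finset.univ.image d := by
      intro i hi
      rw [Finset.mem_range] at hi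
      rw [Finset.mem_image]
      by_cases hin : i = n
      · exact ⟨x g, mem_univ _, by omega⟩
      · obtain ⟨a, ha⟩ := lev (d b - i) (by omega)
        exact ⟨a, mem_univ _, by omega⟩
    have c1 := Finset.card_le_card hsub
    have c2 := (Finset.card_image_le : (Finset.univ.image d).card ≤ _)
    simp at c1 c2
    omega

/-- Feasible market states: allocation `x`, weights `w`, spending lower bound `t`. -/
def Mkt {n m : ℕ} (v : Fin n → Fin m → ℝ) (ε β : ℝ) (x : Fin m → Fin n) (w : Fin n → ℝ) (t : ℝ) :
    Prop :=
  (∀ a, 1 ≤ w a) ∧ (∀ b g, w b * v b g ≤ w (x g) * v (x g) g) ∧ (ε ≤ t ∧ t ≤ β) ∧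
    (∀ a, t ≤ spend (fun a => w a * ε) (fun g => w (x g) * v (x g) g) x a) ∧
    ∀ a, UpOne (fun a => w a * ε) (fun g => w (x g) * v (x g) g) x β a

theorem continuous_spend {n m : ℕ} (v : Fin n → Fin m → ℝ) (ε : ℝ) (x : Fin m → Fin n)
    (a : Fin n) : Continuous (fun z : (Fin n → ℝ) × ℝ =>
      spend (fun a => z.1 a * ε) (fun g => z.1 (x g) * v (x g) g) x a) := by
  unfold spend
  refine Continuous.add (by fun_prop) (continuous_finsetSum _ fun g _ => ?_)
  split_ifs
  · fun_prop
  · fun_prop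

theorem spend_sub_ge {n m : ℕ} (c : Fin n → ℝ) (p : Fin m → ℝ) (hp : ∀ g, 0 ≤ p g)
    (x : Fin m → Fin n) (g : Fin m) : c (x g) ≤ spend c p x (x g) - p g := by
  unfold spend
  have : (if x g = x g then p g else 0) ≤ ∑ g', if x g' = x g then p g' else 0 :=
    Finset.single_le_sum (f := fun g' => if x g' = x g then p g' else 0)
      (fun g' _ => by split_ifs; exacts [hp g', le_rfl]) (mem_univ g)
  simp only [if_true] at this
  linarith

theorem spend_ge {n m : ℕ} (c : Fin n → ℝ) (p : Fin m → ℝ) (hp : ∀ g, 0 ≤ p g)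
    (x : Fin m → Fin n) (a : Fin n) : c a ≤ spend c p x a := by
  unfold spend
  have : 0 ≤ ∑ g', if x g' = a then p g' else 0 :=
    Finset.sum_nonneg (fun g' _ => by split_ifs; exacts [hp g', le_rfl])
  linarith

theorem closed_and {X : Type*} [TopologicalSpace X] {P Q : X → Prop} (hP : IsClosed {z | P z})
    (hQ : IsClosed {z | Q z}) : IsClosed {z | P z ∧ Q z} := hP.inter hQ

theorem closed_or {X : Type*} [TopologicalSpace X] {P Q : X → Prop} (hP : IsClosed {z | P z})
    (hQ : IsClosed {z | Q z}) : IsClosed {z | P z ∨ Q z} := hP.union hQ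

theorem closed_forall {X ι : Type*} [TopologicalSpace X] {P : ι → X → Prop}
    (hP : ∀ i, IsClosed {z | P i z}) : IsClosed {z | ∀ i, P i z} := by
  have : {z | ∀ i, P i z} = ⋂ i, {z | P i z} := by ext z; simp
  rw [this]; exact isClosed_iInter hP

theorem closed_exists {X ι : Type*} [TopologicalSpace X] [Finite ι] {P : ι → X → Prop}
    (hP : ∀ i, IsClosed {z | P i z}) : IsClosed {z | ∃ i, P i z} := by
  have : {z | ∃ i, P i z} = ⋃ i, {z | P i z} := by ext z; simp
  rw [this]; exact isClosed_iUnion_of_finite hP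

theorem compact_Mkt {n m : ℕ} (v : Fin n → Fin m → ℝ) (hv : ∀ i g, 0 ≤ v i g)
    (ε β : ℝ) (hε : 0 < ε) (x : Fin m → Fin n) :
    IsCompact {z : (Fin n → ℝ) × ℝ | Mkt v ε β x z.1 z.2} := by
  refine IsCompact.of_isClosed_subset
    (isCompact_Icc (a := ((fun _ => 1, ε) : (Fin n → ℝ) × ℝ)) (b := (fun _ => β / ε, β))) ?_ ?_
  · unfold Mkt
    refine closed_and ?_ (closed_and ?_ (closed_and (closed_and ?_ ?_) (closed_and ?_ ?_)))
    · exact closed_forall fun a => isClosed_le (by fun_prop) (by fun_prop)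
    · exact closed_forall fun b => closed_forall fun g => isClosed_le (by fun_prop) (by fun_prop)
    · exact isClosed_le (by fun_prop) (by fun_prop)
    · exact isClosed_le (by fun_prop) (by fun_prop)
    · exact closed_forall fun a => isClosed_le (by fun_prop) (continuous_spend v ε x a)
    · refine closed_forall fun a => ?_
      unfold UpOne
      refine closed_or (isClosed_le (continuous_spend v ε x a) (by fun_prop)) ?_
      refine closed_exists fun g => closed_and isClosed_const
        (isClosed_le ((continuous_spend v ε x a).sub (by fun_prop)) (by fun_prop))
  · rintro ⟨w, t⟩ ⟨h1, h2, h3, h4, h5⟩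
    have hp : ∀ g, 0 ≤ w (x g) * v (x g) g := fun g =>
      mul_nonneg (by linarith [h1 (x g)]) (hv _ _)
    refine ⟨⟨h1, h3.1⟩, ⟨fun a => ?_, h3.2⟩⟩
    show w a ≤ β / ε
    rw [le_div_iff₀ hε]
    rcases h5 a with h | ⟨g, rfl, h⟩
    · exact (spend_ge (fun a => w a * ε) _ hp x a).trans h
    · exact (spend_sub_ge (fun a => w a * ε) _ hp x g).trans h

theorem market {n m : ℕ} (hn : 1 ≤ n) (v : Fin n → Fin m → ℝ) (hv : ∀ i g, 0 ≤ v i g)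
    (ε : ℝ) (hε : 0 < ε) :
    ∃ (x : Fin m → Fin n) (w : Fin n → ℝ) (β : ℝ), 0 < β ∧ (∀ a, 0 < w a) ∧
      (∀ b g, w b * v b g ≤ w (x g) * v (x g) g) ∧
      (∀ a, β ≤ spend (fun a => w a * ε) (fun g => w (x g) * v (x g) g) x a) ∧
      ∀ a, UpOne (fun a => w a * ε) (fun g => w (x g) * v (x g) g) x β a := by
  classical
  have : Nonempty (Fin n) := ⟨⟨0, hn⟩⟩
  choose x0 hx0 using fun g : Fin m => Finite.exists_max (fun a => v a g)
  set s0 := spend (fun a => (1 : ℝ) * ε) (fun g => (1 : ℝ) * v (x0 g) g) x0 with hs0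
  have hs0ε : ∀ a, ε ≤ s0 a := fun a => by
    have := spend_ge (fun _ => (1 : ℝ) * ε) (fun g => (1 : ℝ) * v (x0 g) g)
      (fun g => by simpa using hv _ _) x0 a
    simpa [hs0] using this
  obtain ⟨am, ham⟩ := Finite.exists_max s0
  set β := s0 am
  have hβ : ε ≤ β := hs0ε am
  let T : Set ℝ := ⋃ x : Fin m → Fin n, Prod.snd '' {z : (Fin n → ℝ) × ℝ | Mkt v ε β x z.1 z.2}
  have hTc : IsCompact T := isCompact_iUnion fun x => (compact_Mkt v hv ε β hε x).image continuous_snd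
  have hTmem : ∀ t, t ∈ T ↔ ∃ x w, Mkt v ε β x w t := by
    intro t; simp [T]
  have hTne : T.Nonempty := by
    refine ⟨ε, (hTmem _).2 ⟨x0, fun _ => 1, fun _ => le_rfl, ?_, ⟨le_rfl, hβ⟩, hs0ε,
      fun a => Or.inl (ham a)⟩⟩
    intro b g
    simpa using hx0 g b
  obtain ⟨t, htT, htmax⟩ := hTc.exists_isGreatest hTne
  obtain ⟨x1, w, h1, h2, h3, h4, h5⟩ := (hTmem t).1 htT
  have hw : ∀ a, 0 < w a := fun a => by linarith [h1 a]
  have htpos : 0 < t := by linarith [h3.1]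
  rcases h3.2.eq_or_lt with htβ | htβ
  · exact ⟨x1, w, β, by linarith, hw, h2, fun a => htβ ▸ h4 a, h5⟩
  exfalso
  set p : Fin m → ℝ := fun g => w (x1 g) * v (x1 g) g with hp
  set c : Fin n → ℝ := fun a => w a * ε with hc
  have hp0 : ∀ g, 0 ≤ p g := fun g => mul_nonneg (hw _).le (hv _ _)
  obtain ⟨x, C, ⟨hE, hF1, hF2⟩, hC1, hC2, hC3⟩ := discrete c p hp0 (fun b g => w b * v b g = p g)
    t β h3.2 x1 ⟨fun g => rfl, h4, h5⟩
  -- choose the factor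
  have key : ∀ a b : ℝ, a < b → ∀ᶠ θ in nhdsWithin (1 : ℝ) (Set.Ioi 1), θ * a < b := by
    intro a b hab
    have hc : Filter.Tendsto (fun θ : ℝ => θ * a) (nhdsWithin 1 (Set.Ioi 1)) (nhds (1 * a)) :=
      ((continuous_id.mul continuous_const).tendsto 1).mono_left nhdsWithin_le_nhds
    rw [one_mul] at hc
    exact hc.eventually (gt_mem_nhds hab)
  have ev1 : ∀ᶠ θ in nhdsWithin (1 : ℝ) (Set.Ioi 1), ∀ b g, b ∈ C → x g ∉ C →
      θ * (w b * v b g) < p g := by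
    refine Filter.eventually_all.2 fun b => Filter.eventually_all.2 fun g => ?_
    by_cases hb : b ∈ C
    · by_cases hg : x g ∈ C
      · simp [hg]
      · have : w b * v b g < p g :=
          lt_of_le_of_ne (h2 b g) (fun h => hg (hC3 b hb g h))
        filter_upwards [key _ _ this] with θ h _ _ using h
    · simp [hb]
  have ev2 : ∀ᶠ θ in nhdsWithin (1 : ℝ) (Set.Ioi 1), ∀ a, a ∉ C → θ * t < spend c p x a := by
    refine Filter.eventually_all.2 fun a => ?_
    by_cases ha : a ∈ C
    · simp [ha]
    · filter_upwards [key _ _ (hC1 a ha)] with θ h _ using h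
  obtain ⟨θ, ⟨⟨e1, e2⟩, e3⟩, e4⟩ := (((ev1.and ev2).and (key t β htβ)).and
    self_mem_nhdsWithin).exists
  have hθ : 1 < θ := e4
  set w' : Fin n → ℝ := fun a => if a ∈ C then θ * w a else w a with hw'
  have hsp : ∀ a, spend (fun a => w' a * ε) (fun g => w' (x g) * v (x g) g) x a =
      (if a ∈ C then θ else 1) * spend c p x a := by
    intro a
    unfold spend
    rw [mul_add, Finset.mul_sum]
    congr 1
    · simp only [hw', hc]; split_ifs <;> ring
    · refine Finset.sum_congr rfl fun g _ => ?_
      split_ifs with h6 h7 h7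
      · rw [← hE g]; simp only [hw', h6, h7, if_true]; ring
      · rw [← hE g]; simp only [hw', h6, h7, if_false]; ring
      · simp
      · simp
  have hpr : ∀ g, w' (x g) * v (x g) g = (if x g ∈ C then θ else 1) * p g := by
    intro g
    rw [← hE g]; simp only [hw']; split_ifs <;> ring
  have hgt : t < θ * t := by nlinarith
  have : θ * t ∈ T := by
    refine (hTmem _).2 ⟨x, w', ?_, ?_, ⟨by linarith [h3.1], e3.le⟩, ?_, ?_⟩
    · intro a
      simp only [hw']
      split_ifs
      · nlinarith [h1 a]
      · exact h1 a
    · intro b g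
      rw [hpr]
      have h2' : w b * v b g ≤ p g := h2 b g
      have := hp0 g
      simp only [hw']
      split_ifs with h6 h7 h7
      · rw [mul_assoc]; exact mul_le_mul_of_nonneg_left h2' (by linarith)
      · rw [one_mul, mul_assoc]; exact (e1 b g h6 h7).le
      · nlinarith
      · linarith
    · intro a
      rw [hsp]
      split_ifs with h6
      · exact mul_le_mul_of_nonneg_left (hF1 a) (by linarith)
      · rw [one_mul]; exact (e2 a h6).le
    · intro a
      unfold UpOne
      rw [hsp]
      simp only [hpr]
      by_cases h6 : a ∈ C
      · simp only [h6, if_true]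
        rcases hC2 a h6 with h | ⟨g, rfl, h⟩
        · left; exact (mul_le_mul_of_nonneg_left h (by linarith)).trans e3.le
        · right; refine ⟨g, rfl, ?_⟩
          simp only [h6, if_true]
          rw [← mul_sub]
          exact (mul_le_mul_of_nonneg_left h (by linarith)).trans e3.le
      · simp only [h6, if_false, one_mul]
        rcases hF2 a with h | ⟨g, rfl, h⟩
        · left; exact h
        · right; refine ⟨g, rfl, ?_⟩
          simp only [h6, if_false, one_mul]
          exact h
  exact absurd (htmax this) (not_le.2 hgt)

/-- Factor contributed by a good of normalized price `u`. -/
def fac (u : ℝ) : ℝ := if 1 < u then Real.exp 1 * u else Real.exp u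

theorem two_le_exp_one : (2 : ℝ) ≤ Real.exp 1 := by
  have := Real.add_one_le_exp (1 : ℝ); linarith

theorem bundle_upper {ι : Type*} (u : ι → ℝ) (hu : ∀ i, 0 ≤ u i) (S : Finset ι) :
    ∀ r : ℝ, 0 ≤ r → r + ∑ i ∈ S, u i ≤ Real.exp (r - 1) * ∏ i ∈ S, fac (u i) ∧
      1 + (r + ∑ i ∈ S, u i) ≤ Real.exp 1 * (Real.exp (r - 1) * ∏ i ∈ S, fac (u i)) := by
  classical
  induction S using Finset.induction_on with
  | empty =>
    intro r hr
    have h1 := Real.add_one_le_exp (r - 1)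
    have h2 := Real.add_one_le_exp r
    simp only [Finset.sum_empty, Finset.prod_empty, mul_one, ← Real.exp_add]
    constructor
    · linarith
    · rw [show 1 + (r - 1) = r by ring]; linarith
  | insert g S hg ih =>
    intro r hr
    rw [Finset.sum_insert hg, Finset.prod_insert hg]
    by_cases h : 1 < u g
    · obtain ⟨i1, i2⟩ := ih r hr
      have hS : 0 ≤ ∑ i ∈ S, u i := Finset.sum_nonneg fun i _ => hu i
      have he := two_le_exp_one
      rw [fac, if_pos h]
      set Q := Real.exp (r - 1) * ∏ i ∈ S, fac (u i)
      rw [show Real.exp (r - 1) * (Real.exp 1 * u g * ∏ i ∈ S, fac (u i)) =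
        u g * (Real.exp 1 * Q) by simp only [Q]; ring]
      have i3 : u g * (1 + (r + ∑ i ∈ S, u i)) ≤ u g * (Real.exp 1 * Q) :=
        mul_le_mul_of_nonneg_left i2 (hu g)
      have i4 : r + (u g + ∑ i ∈ S, u i) ≤ u g * (1 + (r + ∑ i ∈ S, u i)) := by nlinarith
      refine ⟨i4.trans i3, ?_⟩
      have i5 : 2 * (u g * (Real.exp 1 * Q)) ≤ Real.exp 1 * (u g * (Real.exp 1 * Q)) :=
        mul_le_mul_of_nonneg_right he (by nlinarith)
      nlinarith
    · obtain ⟨i1, i2⟩ := ih (r + u g) (by linarith [hu g])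
      rw [fac, if_neg h]
      have e1 : Real.exp (r - 1) * (Real.exp (u g) * ∏ i ∈ S, fac (u i)) =
          Real.exp (r + u g - 1) * ∏ i ∈ S, fac (u i) := by
        rw [← mul_assoc, ← Real.exp_add]; ring_nf
      rw [e1]
      constructor <;> linarith

theorem prod_fac_light {ι : Type*} (u : ι → ℝ) (S : Finset ι) (h : ∀ i ∈ S, u i ≤ 1) :
    ∏ i ∈ S, fac (u i) = Real.exp (∑ i ∈ S, u i) := by
  rw [Real.exp_sum]
  exact Finset.prod_congr rfl fun i hi => by rw [fac, if_neg (not_lt.2 (h i hi))]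

theorem bundle_lower {ι : Type*} (u : ι → ℝ) (hu : ∀ i, 0 ≤ u i) (S : Finset ι)
    (r : ℝ) (hr : 0 ≤ r) (b : ℝ) (hb : b = Real.exp (-1)) (h1 : b ≤ r + ∑ i ∈ S, u i)
    (h2 : r + ∑ i ∈ S, u i ≤ b ∨ ∃ g ∈ S, r + ∑ i ∈ S, u i - u g ≤ b) :
    Real.exp (r - 1) * ∏ i ∈ S, fac (u i) ≤ Real.exp b * (r + ∑ i ∈ S, u i) := by
  classical
  have hb0 : 0 < b := by rw [hb]; exact Real.exp_pos _
  have hb1 : b < 1 := by rw [hb]; rw [Real.exp_lt_one_iff]; norm_num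
  by_cases hl : ∀ i ∈ S, u i ≤ 1
  · rw [prod_fac_light u S hl, ← Real.exp_add]
    set σ := r + ∑ i ∈ S, u i with hσ
    have h3 : σ ≤ b + 1 := by
      rcases h2 with h | ⟨g, hg, h⟩
      · linarith
      · linarith [hl g hg]
    have hcv := convexOn_exp.2 (Set.mem_univ (-1 : ℝ)) (Set.mem_univ (0 : ℝ))
      (show 0 ≤ 1 - (σ - b) by linarith) (show 0 ≤ σ - b by linarith) (by ring)
    simp only [smul_eq_mul, Real.exp_zero, mul_zero, add_zero, mul_one] at hcv
    rw [← hb] at hcv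
    have h4 : Real.exp ((1 - (σ - b)) * -1) ≤ σ := by nlinarith
    calc Real.exp (r - 1 + ∑ i ∈ S, u i) = Real.exp b * Real.exp ((1 - (σ - b)) * -1) := by
          rw [← Real.exp_add, hσ]; ring_nf
      _ ≤ _ := mul_le_mul_of_nonneg_left h4 (Real.exp_pos _).le
  · push Not at hl
    obtain ⟨g0, hg0, hu0⟩ := hl
    have hsplit := Finset.add_sum_erase S u hg0
    have hpos : 0 ≤ ∑ i ∈ S.erase g0, u i := Finset.sum_nonneg fun i _ => hu i
    have h3 : r + ∑ i ∈ S.erase g0, u i ≤ b := by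
      rcases h2 with h | ⟨g, hg, h⟩
      · linarith
      · by_cases hgg : g = g0
        · subst hgg; linarith
        · exfalso
          have := Finset.single_le_sum (f := u) (fun i _ => hu i)
            (Finset.mem_erase.2 ⟨hgg, hg⟩)
          linarith
    have hl : ∀ i ∈ S.erase g0, u i ≤ 1 := by
      intro i hi
      have := Finset.single_le_sum (f := u) (fun i _ => hu i) hi
      linarith
    rw [← Finset.mul_prod_erase S _ hg0, prod_fac_light u _ hl, fac, if_pos hu0, ← hsplit]
    calc Real.exp (r - 1) * (Real.exp 1 * u g0 * Real.exp (∑ i ∈ S.erase g0, u i))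
        = Real.exp (r + ∑ i ∈ S.erase g0, u i) * u g0 := by
          rw [show r + ∑ i ∈ S.erase g0, u i = (r - 1) + 1 + ∑ i ∈ S.erase g0, u i by ring,
            Real.exp_add, Real.exp_add]; ring
      _ ≤ Real.exp b * (r + (u g0 + ∑ i ∈ S.erase g0, u i)) := by
          apply mul_le_mul (Real.exp_le_exp.2 h3) (by linarith) (hu g0) (Real.exp_pos _).le

theorem fac_pos {u : ℝ} : 0 < fac u := by
  unfold fac
  split_ifs with h
  · have := Real.exp_pos 1; nlinarith
  · exact Real.exp_pos _

/-- Approximation of Nash welfare at the level of prices. -/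
theorem nsw_price {n m : ℕ} (c : Fin n → ℝ) (hc : ∀ a, 0 ≤ c a) (p : Fin m → ℝ)
    (hp : ∀ g, 0 ≤ p g) (β : ℝ) (hβ : 0 < β) (x y : Fin m → Fin n)
    (h1 : ∀ a, β ≤ spend c p x a) (h2 : ∀ a, UpOne c p x β a) :
    ∏ a, spend c p y a ≤ Real.exp (n / Real.exp 1) * ∏ a, spend c p x a := by
  classical
  set t := Real.exp 1 * β with ht
  have ht0 : 0 < t := mul_pos (Real.exp_pos _) hβ
  set b := Real.exp (-1) with hb
  have hbt : b * t = β := by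
    rw [ht, hb, ← mul_assoc, ← Real.exp_add]; simp
  set u : Fin m → ℝ := fun g => p g / t with hu
  have hu0 : ∀ g, 0 ≤ u g := fun g => div_nonneg (hp g) ht0.le
  have hsp : ∀ (z : Fin m → Fin n) a,
      spend c p z a = t * (c a / t + ∑ g with z g = a, u g) := by
    intro z a
    unfold spend
    rw [mul_add, mul_div_cancel₀ _ ht0.ne', Finset.mul_sum, Finset.sum_filter]
    congr 1
    refine Finset.sum_congr rfl fun g _ => ?_
    simp only [hu]
    rw [mul_div_cancel₀ _ ht0.ne']
  have hcn : ∀ a, 0 ≤ c a / t := fun a => div_nonneg (hc a) ht0.le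
  have hfib : ∀ z : Fin m → Fin n,
      ∏ a, (t * (Real.exp (c a / t - 1) * ∏ g with z g = a, fac (u g))) =
      (∏ a, (t * Real.exp (c a / t - 1))) * ∏ g, fac (u g) := by
    intro z
    rw [← Finset.prod_fiberwise univ z (fun g => fac (u g)), ← Finset.prod_mul_distrib]
    exact Finset.prod_congr rfl fun a _ => by ring
  have hbinv : b = 1 / Real.exp 1 := by rw [hb, Real.exp_neg]; simp
  calc ∏ a, spend c p y a
      ≤ ∏ a, (t * (Real.exp (c a / t - 1) * ∏ g with y g = a, fac (u g))) := by
        refine Finset.prod_le_prod (fun a _ => (hc a).trans (spend_ge c p hp y a)) fun a _ => ?_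
        rw [hsp]
        exact mul_le_mul_of_nonneg_left (bundle_upper u hu0 _ _ (hcn a)).1 ht0.le
    _ = ∏ a, (t * (Real.exp (c a / t - 1) * ∏ g with x g = a, fac (u g))) := by
        rw [hfib, hfib]
    _ ≤ ∏ a, (Real.exp b * spend c p x a) := by
        refine Finset.prod_le_prod (fun a _ => ?_) fun a _ => ?_
        · exact mul_nonneg ht0.le (mul_nonneg (Real.exp_pos _).le
            (Finset.prod_nonneg fun g _ => fac_pos.le))
        · have e1 : β ≤ spend c p x a := h1 a
          have e2 := h2 a
          unfold UpOne at e2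
          rw [hsp] at e1 e2 ⊢
          have := bundle_lower u hu0 {g | x g = a} (c a / t) (hcn a) b hb
            (by rw [← hbt] at e1; nlinarith) (by
              rcases e2 with e | ⟨g, hg, e⟩
              · left; rw [← hbt, mul_comm b] at e; exact le_of_mul_le_mul_left e ht0
              · right
                refine ⟨g, by simpa using hg, ?_⟩
                have hpg : p g = t * u g := by
                  simp only [hu]; rw [mul_div_cancel₀ _ ht0.ne']
                rw [hpg, ← mul_sub, ← hbt, mul_comm b] at e
                exact le_of_mul_le_mul_left e ht0)
          calc _ ≤ t * (Real.exp b * (c a / t + ∑ g with x g = a, u g)) :=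
                mul_le_mul_of_nonneg_left this ht0.le
            _ = _ := by ring
    _ = _ := by
        rw [Finset.prod_mul_distrib, Finset.prod_const, ← Real.exp_nat_mul, hbinv]
        simp [div_eq_mul_inv]

/-- Bundles of an assignment. -/
def bund {n m : ℕ} (x : Fin m → Fin n) (a : Fin n) : Finset (Fin m) := {g | x g = a}

theorem mem_bund {n m : ℕ} (x : Fin m → Fin n) (a : Fin n) (g : Fin m) :
    g ∈ bund x a ↔ x g = a := by simp [bund]

/-- The approximate version of the claim. -/
def Approx {n m : ℕ} (v : Fin n → Fin m → ℝ) (ε : ℝ) (x : Fin m → Fin n) : Prop :=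
  FPO v (bund x) ∧
  (∀ i j, val v i (bund x j) ≤ val v i (bund x i) + ε ∨
    ∃ g ∈ bund x j, val v i ((bund x j).erase g) ≤ val v i (bund x i) + ε) ∧
  ∀ y : Fin m → Fin n, ∏ i, val v i (bund y i) ≤
    Real.exp (n / Real.exp 1) * ∏ i, (val v i (bund x i) + ε)

theorem val_nonneg {n m : ℕ} (v : Fin n → Fin m → ℝ) (hv : ∀ i g, 0 ≤ v i g) (i : Fin n)
    (S : Finset (Fin m)) : 0 ≤ val v i S := Finset.sum_nonneg fun g _ => hv i g

theorem Approx.mono {n m : ℕ} (v : Fin n → Fin m → ℝ) (hv : ∀ i g, 0 ≤ v i g) {ε ε' : ℝ}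
    (hε : 0 < ε) (h : ε ≤ ε') {x : Fin m → Fin n} (hx : Approx v ε x) : Approx v ε' x := by
  obtain ⟨h1, h2, h3⟩ := hx
  refine ⟨h1, fun i j => ?_, fun y => (h3 y).trans ?_⟩
  · rcases h2 i j with h4 | ⟨g, hg, h4⟩
    · left; linarith
    · right; exact ⟨g, hg, by linarith⟩
  · refine mul_le_mul_of_nonneg_left ?_ (Real.exp_pos _).le
    refine Finset.prod_le_prod (fun i _ => ?_) fun i _ => by linarith
    linarith [val_nonneg v hv i (bund x i)]

theorem spend_eq {n m : ℕ} (c : Fin n → ℝ) (p : Fin m → ℝ) (x : Fin m → Fin n) (a : Fin n) :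
    spend c p x a = c a + ∑ g ∈ bund x a, p g := by
  rw [spend, bund, Finset.sum_filter]

theorem fpo_of_weights {n m : ℕ} (v : Fin n → Fin m → ℝ) (hv : ∀ i g, 0 ≤ v i g)
    (x : Fin m → Fin n) (w : Fin n → ℝ) (hw : ∀ a, 0 < w a)
    (h : ∀ b g, w b * v b g ≤ w (x g) * v (x g) g) : FPO v (bund x) := by
  rintro ⟨y, ⟨hy1, hy2⟩, hle, j, hlt⟩
  have h1 : ∑ i, w i * val v i (bund x i) < ∑ i, w i * fval v i y :=
    Finset.sum_lt_sum (fun i _ => mul_le_mul_of_nonneg_left (hle i) (hw i).le)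
      ⟨j, mem_univ _, mul_lt_mul_of_pos_left hlt (hw j)⟩
  have h2 : ∑ i, w i * val v i (bund x i) = ∑ g, w (x g) * v (x g) g := by
    rw [← Finset.sum_fiberwise univ x (fun g => w (x g) * v (x g) g)]
    refine Finset.sum_congr rfl fun i _ => ?_
    rw [_root_.val, Finset.mul_sum, bund]
    refine Finset.sum_congr rfl fun g hg => ?_
    rw [(Finset.mem_filter.1 hg).2]
  have h3 : ∑ i, w i * fval v i y ≤ ∑ g, w (x g) * v (x g) g := by
    simp only [fval, Finset.mul_sum]
    rw [Finset.sum_comm]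
    refine Finset.sum_le_sum fun g _ => ?_
    calc ∑ i, w i * (y i g * v i g) ≤ ∑ i, y i g * (w (x g) * v (x g) g) :=
          Finset.sum_le_sum fun i _ => by
            have := mul_le_mul_of_nonneg_left (h i g) (hy1 i g).1
            linarith
      _ = (∑ i, y i g) * (w (x g) * v (x g) g) := by rw [Finset.sum_mul]
      _ ≤ 1 * (w (x g) * v (x g) g) :=
          mul_le_mul_of_nonneg_right (hy2 g) (mul_nonneg (hw _).le (hv _ _))
      _ = _ := one_mul _
  linarith

theorem exists_approx {n m : ℕ} (hn : 1 ≤ n) (v : Fin n → Fin m → ℝ) (hv : ∀ i g, 0 ≤ v i g)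
    (ε : ℝ) (hε : 0 < ε) : ∃ x : Fin m → Fin n, Approx v ε x := by
  obtain ⟨x, w, β, hβ, hw, hmbb, hlow, hup⟩ := market hn v hv ε hε
  have hp0 : ∀ g, 0 ≤ w (x g) * v (x g) g := fun g => mul_nonneg (hw _).le (hv _ _)
  have hsx : ∀ a, spend (fun a => w a * ε) (fun g => w (x g) * v (x g) g) x a =
      w a * (val v a (bund x a) + ε) := by
    intro a
    rw [spend_eq, _root_.val, mul_add, Finset.mul_sum, add_comm]
    congr 1
    refine Finset.sum_congr rfl fun g hg => ?_
    rw [(mem_bund x a g).1 hg]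
  have hpS : ∀ i (S : Finset (Fin m)), w i * val v i S ≤ ∑ g ∈ S, w (x g) * v (x g) g := by
    intro i S
    rw [_root_.val, Finset.mul_sum]
    exact Finset.sum_le_sum fun g _ => hmbb i g
  refine ⟨x, fpo_of_weights v hv x w hw hmbb, fun i j => ?_, fun y => ?_⟩
  · have hli := hlow i
    rw [hsx] at hli
    have hwj : 0 ≤ w j * ε := (mul_pos (hw j) hε).le
    rcases hup j with h | ⟨g, hg, h⟩
    · left
      rw [spend_eq] at h
      have := hpS i (bund x j)
      refine le_of_mul_le_mul_left ?_ (hw i)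
      linarith
    · right
      have hgm := (mem_bund x j g).2 hg
      refine ⟨g, hgm, ?_⟩
      rw [spend_eq, ← Finset.add_sum_erase _ _ hgm] at h
      have := hpS i ((bund x j).erase g)
      refine le_of_mul_le_mul_left ?_ (hw i)
      linarith
  · have hmain := nsw_price (fun a => w a * ε) (fun a => (mul_pos (hw a) hε).le) _ hp0 β hβ x y
      hlow hup
    have h1 : ∏ a, (w a * val v a (bund y a)) ≤
        ∏ a, spend (fun a => w a * ε) (fun g => w (x g) * v (x g) g) y a := by
      refine Finset.prod_le_prod (fun a _ => mul_nonneg (hw a).le (val_nonneg v hv _ _))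
        fun a _ => ?_
      rw [spend_eq]
      have := hpS a (bund y a)
      have := mul_pos (hw a) hε
      linarith
    have h2 := h1.trans hmain
    simp only [hsx] at h2
    rw [Finset.prod_mul_distrib, Finset.prod_mul_distrib] at h2
    have hW : 0 < ∏ a, w a := Finset.prod_pos fun a _ => hw a
    refine le_of_mul_le_mul_left ?_ hW
    linarith

theorem exists_limit {n m : ℕ} (hn : 1 ≤ n) (v : Fin n → Fin m → ℝ) (hv : ∀ i g, 0 ≤ v i g) :
    ∃ x : Fin m → Fin n, ∀ ε, 0 < ε → Approx v ε x := by
  by_contra hcon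
  push Not at hcon
  choose e he hne using hcon
  have : Nonempty (Fin m → Fin n) := ⟨fun _ => ⟨0, hn⟩⟩
  obtain ⟨x0, hx0⟩ := Finite.exists_min e
  obtain ⟨x, hx⟩ := exists_approx hn v hv (e x0) (he x0)
  exact hne x (hx.mono v hv (he x0) (hx0 x))

/-- There exists an allocation that is EF1, fPO, and an
`e^{1/e}`-approximation to the maximum Nash social welfare. -/
theorem ef1_fpo_nsw_exists {n m : ℕ} (hn : 1 ≤ n) (v : Fin n → Fin m → ℝ)
    (hv : ∀ i g, 0 ≤ v i g)
    (hgood : ∀ g : Fin m, ∃ i : Fin n, 0 < v i g)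
    (hagent : ∀ i : Fin n, ∃ g : Fin m, 0 < v i g) :
    ∃ x : Fin n → Finset (Fin m), IsAllocation x ∧ EF1 v x ∧ FPO v x ∧
      ∀ y : Fin n → Finset (Fin m), IsAllocation y →
        Real.exp (-(n : ℝ) / Real.exp 1) * ∏ i, val v i (y i) ≤ ∏ i, val v i (x i) := by
  obtain ⟨x, hx⟩ := exists_limit hn v hv
  refine ⟨bund x, fun g => ⟨x g, (mem_bund x _ g).2 rfl, fun i hi => ((mem_bund x i g).1 hi).symm⟩,
    ?_, (hx 1 one_pos).1, ?_⟩
  · intro i j hij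
    by_contra hcon
    push Not at hcon
    -- a uniform gap
    have key : ∀ a b : ℝ, a < b → ∀ᶠ ε in nhdsWithin (0 : ℝ) (Set.Ioi 0), a + ε < b := by
      intro a b hab
      have hc : Filter.Tendsto (fun ε : ℝ => a + ε) (nhdsWithin 0 (Set.Ioi 0)) (nhds (a + 0)) :=
        ((continuous_const.add continuous_id).tendsto 0).mono_left nhdsWithin_le_nhds
      rw [add_zero] at hc
      exact hc.eventually (gt_mem_nhds hab)
    have ev : ∀ᶠ ε in nhdsWithin (0 : ℝ) (Set.Ioi 0), ∀ g, g ∈ bund x j →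
        val v i (bund x i) + ε < val v i ((bund x j).erase g) := by
      refine Filter.eventually_all.2 fun g => ?_
      by_cases hg : g ∈ bund x j
      · filter_upwards [key _ _ (hcon g hg)] with ε h _ using h
      · simp [hg]
    obtain ⟨ε, ⟨e1, e2⟩, e3⟩ := ((ev.and (key _ _ hij)).and self_mem_nhdsWithin).exists
    rcases (hx ε e3).2.1 i j with h | ⟨g, hg, h⟩
    · linarith
    · linarith [e1 g hg]
  · intro y hy
    choose y' hy' hyu using hy
    have hyb : y = bund y' := by
      funext i
      ext g
      rw [mem_bund]
      constructor
      · intro h; exact (hyu g i h).symm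
      · rintro rfl; exact hy' g
    subst hyb
    have hlim : ∏ i, val v i (bund y' i) ≤
        Real.exp (n / Real.exp 1) * ∏ i, val v i (bund x i) := by
      have hc : Continuous (fun ε : ℝ => Real.exp (n / Real.exp 1) *
          ∏ i, (val v i (bund x i) + ε)) := by fun_prop
      have ht := (hc.tendsto 0).mono_left (nhdsWithin_le_nhds (s := Set.Ioi 0))
      simp only [add_zero] at ht
      refine ge_of_tendsto ht ?_
      filter_upwards [self_mem_nhdsWithin] with ε hε
      exact (hx ε hε).2.2 y'
    calc _ ≤ Real.exp (-(n : ℝ) / Real.exp 1) *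
          (Real.exp (n / Real.exp 1) * ∏ i, val v i (bund x i)) :=
          mul_le_mul_of_nonneg_left hlim (Real.exp_pos _).le
      _ = _ := by
          rw [← mul_assoc, ← Real.exp_add, neg_div, neg_add_cancel, Real.exp_zero, one_mul]
end
end

section
/- Let (N, M, V) be a fair division instance in which all agents have identical additive valuations, i.e., there are values v_g ≥ 0 with v_{ig} = v_g for every agent i and good g. Then every EF1 allocation x satisfies Π_{i∈N} v(x_i) ≥ e^{-n/e} · Π_{i∈N} v(y_i) for every allocation y; that is, any EF1 allocation provides an e^{1/e}-approximation for the Nash social welfare maximization problem. -/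
open Finset

noncomputable section

/-- Key inequality bounding a bundle containing goods of (normalised) value at least one. -/
lemma bundle_bound {ι : Type*} (S : Finset ι) (b : ι → ℝ) (hb : ∀ j ∈ S, 1 ≤ b j) (z : ℝ)
    (hz : 0 < z) (hS : ∑ j ∈ S, b j ≤ z) :
    Real.log z ≤ ∑ j ∈ S, (Real.log (b j) - (b j - 1)) + (z - 1) := by
  rcases S.eq_empty_or_nonempty with rfl | hne
  · simpa using Real.log_le_sub_one_of_pos hz
  have hlog : ∀ j ∈ S, 0 ≤ Real.log (b j) := fun j hj => Real.log_nonneg (hb j hj)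
  have hcard : (1 : ℝ) ≤ S.card := by exact_mod_cast hne.card_pos
  have hB1 : (S.card : ℝ) ≤ ∑ j ∈ S, b j := by
    simpa using Finset.card_nsmul_le_sum S b 1 hb
  set B := ∑ j ∈ S, b j with hB
  have hBpos : 0 < B := by linarith
  have h1 : B ≤ S.card * Real.exp (∑ j ∈ S, Real.log (b j)) := by
    have := Finset.sum_le_card_nsmul S b (Real.exp (∑ j ∈ S, Real.log (b j))) (by
      intro j hj
      rw [← Real.exp_log (show 0 < b j by linarith [hb j hj])]
      apply Real.exp_le_exp.2
      exact Finset.single_le_sum (f := fun j => Real.log (b j)) hlog hj)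
    simpa using this
  have h2 : Real.log B ≤ Real.log S.card + ∑ j ∈ S, Real.log (b j) := by
    have := Real.log_le_log hBpos h1
    rwa [Real.log_mul (by positivity) (by positivity), Real.log_exp] at this
  have h3 : Real.log (S.card : ℝ) ≤ S.card - 1 :=
    Real.log_le_sub_one_of_pos (by linarith)
  have h4 : Real.log z ≤ Real.log B + (z - B) := by
    have h5 := Real.log_le_sub_one_of_pos (div_pos hz hBpos)
    rw [Real.log_div hz.ne' hBpos.ne'] at h5
    have h6 : z / B - 1 ≤ z - B := by
      rw [div_sub_one hBpos.ne', div_le_iff₀ hBpos]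
      nlinarith
    linarith
  have h7 : ∑ j ∈ S, (Real.log (b j) - (b j - 1))
      = ∑ j ∈ S, Real.log (b j) - (B - S.card) := by
    simp [Finset.sum_sub_distrib, hB]
  rw [h7]
  linarith

/-- Secant bound for the logarithm. -/
lemma secant_bound (c a x : ℝ) (hc : 1 ≤ c) (hx1 : 1 ≤ x) (hax : a ≤ x) (hxa : x ≤ a + 1) :
    Real.log (max c a) - Real.log x
      ≤ Real.log c / c + Real.log c / c * (max c a - x) := by
  have hμ : 0 ≤ Real.log c / c := div_nonneg (Real.log_nonneg hc) (by linarith)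
  rcases le_total c a with h | h
  · rw [max_eq_right h]
    have : Real.log a ≤ Real.log x := Real.log_le_log (by linarith) hax
    nlinarith
  · rw [max_eq_left h]
    have hcp : 0 < c := by linarith
    rcases le_total c x with h' | h'
    · have : Real.log c ≤ Real.log x := Real.log_le_log (by linarith) h'
      nlinarith
    · -- here `1 ≤ x ≤ c`; use concavity between `1` and `c`
      rcases eq_or_lt_of_le hc with h1 | h1
      · have : x = 1 := by linarith
        subst this; subst h1; simp
      have hcv : ∀ p q : ℝ, 0 ≤ p → 0 ≤ q → p + q = 1 →
          p • Real.log 1 + q • Real.log c ≤ Real.log (p • 1 + q • c) := fun p q hp hq hpq =>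
        (And.right strictConcaveOn_log_Ioi.concaveOn) (by simp) (by simpa using hcp) hp hq hpq
      have hconc := hcv ((c - x) / (c - 1)) ((x - 1) / (c - 1))
        (div_nonneg (by linarith) (by linarith)) (div_nonneg (by linarith) (by linarith))
        (by rw [← add_div, div_eq_one_iff_eq (by linarith)]; ring)
      have hne : c - 1 ≠ 0 := by linarith
      have he : (c - x) / (c - 1) * 1 + (x - 1) / (c - 1) * c = x := by
        field_simp; ring
      simp only [smul_eq_mul, Real.log_one, mul_zero, zero_add] at hconc
      rw [he] at hconc
      have hL := Real.log_nonneg hc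
      have h8 : (1 - (1 + c - x) / c) ≤ (x - 1) / (c - 1) := by
        rw [one_sub_div hcp.ne', div_le_div_iff₀ hcp (by linarith)]
        nlinarith
      have h9 : Real.log c / c + Real.log c / c * (c - x)
        = Real.log c * ((1 + c - x) / c) := by ring
      rw [h9]
      nlinarith [mul_le_mul_of_nonneg_left h8 hL]

/-- Normalised numerical core of the theorem. -/
lemma nsw_core {n : ℕ} (hn : 1 ≤ n) (a X Y : Fin n → ℝ) (σ : Fin n → Fin n)
    (hX : ∀ j, 1 ≤ X j) (haX : ∀ j, a j ≤ X j) (hXa : ∀ j, X j ≤ a j + 1)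
    (ha : ∀ j, 0 ≤ a j)
    (hsum : ∑ i, X i = ∑ i, Y i) (hY : ∀ i, 0 < Y i)
    (hσ : ∀ i, ∑ j with σ j = i, a j ≤ Y i) :
    Real.exp (-(n : ℝ) / Real.exp 1) * ∏ i, Y i ≤ ∏ i, X i := by
  set T := ∑ i, X i with hT
  have hcont : Continuous (fun c : ℝ => ∑ j, max c (a j)) := by fun_prop
  have hTn : (n : ℝ) ≤ T := by
    simpa using Finset.card_nsmul_le_sum univ X 1 (fun j _ => hX j)
  have hn' : (1 : ℝ) ≤ n := by exact_mod_cast hn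
  obtain ⟨c, hc, hcT⟩ : ∃ c : ℝ, 1 ≤ c ∧ ∑ j, max c (a j) = T := by
    have := intermediate_value_Icc (show (1 : ℝ) ≤ T by linarith) hcont.continuousOn
    obtain ⟨c, hc, h⟩ := this (show T ∈ _ from
      ⟨Finset.sum_le_sum fun j _ => max_le (hX j) (haX j), by
        have h1 := Finset.card_nsmul_le_sum univ (fun j => max T (a j)) T
          (fun j _ => le_max_left _ _)
        simp only [card_univ, Fintype.card_fin, nsmul_eq_mul] at h1
        refine le_trans ?_ h1
        nlinarith⟩)
    exact ⟨c, hc.1, h⟩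
  have hcp : 0 < c := by linarith
  -- upper bound for `y`
  have hup : ∑ i, Real.log (Y i) ≤ ∑ j, Real.log (max c (a j)) := by
    have h1 : ∀ i, Real.log (Y i) ≤ Real.log c +
        (∑ j with σ j = i, (Real.log (max c (a j) / c) - (max c (a j) / c - 1))
          + (Y i / c - 1)) := by
      intro i
      have h2 := bundle_bound ({j | σ j = i ∧ c ≤ a j} : Finset (Fin n))
        (fun j => max c (a j) / c) (by
          intro j _
          rw [le_div_iff₀ hcp]; simp) (Y i / c) (div_pos (hY i) hcp) (by
          rw [← Finset.sum_div]
          apply div_le_div_of_nonneg_right _ hcp.le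
          refine le_trans ?_ (hσ i)
          calc _ = ∑ j with (σ j = i ∧ c ≤ a j), a j := by
                apply Finset.sum_congr rfl
                intro j hj
                simp only [mem_filter] at hj
                exact max_eq_right hj.2.2
            _ ≤ _ := by
                apply Finset.sum_le_sum_of_subset_of_nonneg
                · intro j hj
                  simp only [mem_filter] at hj ⊢
                  exact ⟨hj.1, hj.2.1⟩
                · intro j _ _
                  exact ha j)
      rw [Real.log_div (hY i).ne' hcp.ne'] at h2
      have h3 : ∑ j with (σ j = i ∧ c ≤ a j),
          (Real.log (max c (a j) / c) - (max c (a j) / c - 1))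
          = ∑ j with σ j = i, (Real.log (max c (a j) / c) - (max c (a j) / c - 1)) := by
        apply Finset.sum_subset
        · intro j hj
          simp only [mem_filter] at hj ⊢
          exact ⟨hj.1, hj.2.1⟩
        · intro j hj hj'
          simp only [mem_filter, mem_univ, true_and, not_and, not_le] at hj hj'
          rw [max_eq_left (hj' hj).le, div_self hcp.ne']
          simp
      rw [h3] at h2
      linarith
    refine (Finset.sum_le_sum fun i _ => h1 i).trans (le_of_eq ?_)
    rw [Finset.sum_add_distrib, Finset.sum_add_distrib, Finset.sum_fiberwise]
    have h4 : ∀ j, Real.log (max c (a j) / c) = Real.log (max c (a j)) - Real.log c :=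
      fun j => Real.log_div (by positivity) hcp.ne'
    simp only [h4, Finset.sum_sub_distrib, ← Finset.sum_div, hcT, ← hsum]
    ring
  have hlow : ∑ j, (Real.log (max c (a j)) - Real.log (X j)) ≤ n / Real.exp 1 := by
    refine (Finset.sum_le_sum fun j _ =>
      secant_bound c (a j) (X j) hc (hX j) (haX j) (hXa j)).trans ?_
    rw [Finset.sum_add_distrib, ← Finset.mul_sum, Finset.sum_sub_distrib, hcT, ← hT]
    simp only [sub_self, mul_zero, add_zero, sum_const, card_univ, Fintype.card_fin,
      nsmul_eq_mul]
    have h5 := Real.log_le_sub_one_of_pos (div_pos hcp (Real.exp_pos 1))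
    rw [Real.log_div hcp.ne' (Real.exp_pos 1).ne', Real.log_exp] at h5
    have h6 : Real.log c / c ≤ 1 / Real.exp 1 := by
      rw [div_le_iff₀ hcp, one_div_mul_eq_div]; linarith
    calc (n : ℝ) * (Real.log c / c) ≤ n * (1 / Real.exp 1) := by gcongr
      _ = _ := by ring
  rw [Finset.sum_sub_distrib] at hlow
  have hXp : ∀ j, 0 < X j := fun j => by linarith [hX j]
  have e1 : ∏ i, Y i = Real.exp (∑ i, Real.log (Y i)) := by
    rw [Real.exp_sum]; exact Finset.prod_congr rfl fun i _ => (Real.exp_log (hY i)).symm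
  have e2 : ∏ i, X i = Real.exp (∑ i, Real.log (X i)) := by
    rw [Real.exp_sum]; exact Finset.prod_congr rfl fun i _ => (Real.exp_log (hXp i)).symm
  rw [e1, e2, ← Real.exp_add]
  apply Real.exp_le_exp.2
  rw [neg_div]
  linarith

/-- With identical additive valuations, every EF1 allocation is an
`e^{1/e}`-approximation to the maximum Nash social welfare. -/
theorem ef1_identical_nsw {n m : ℕ} (hn : 1 ≤ n)
    (v : Fin n → Fin m → ℝ) (w : Fin m → ℝ) (hw : ∀ g, 0 ≤ w g)
    (hid : ∀ i g, v i g = w g)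
    (x : Fin n → Finset (Fin m)) (hx : IsAllocation x) (hEF1 : EF1 v x) :
    ∀ y : Fin n → Finset (Fin m), IsAllocation y →
      Real.exp (-(n : ℝ) / Real.exp 1) * ∏ i, val v i (y i) ≤ ∏ i, val v i (x i) := by
  intro y hy
  have hval : ∀ i S, val v i S = ∑ g ∈ S, w g := fun i S =>
    Finset.sum_congr rfl fun g _ => hid i g
  have hE : ∀ i j : Fin n, ∑ g ∈ x i, w g < ∑ g ∈ x j, w g →
      ∃ g ∈ x j, ∑ g ∈ (x j).erase g, w g ≤ ∑ g ∈ x i, w g := by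
    simpa only [EF1, hval] using hEF1
  simp only [hval]
  have hnn : ∀ S : Finset (Fin m), 0 ≤ ∑ g ∈ S, w g := fun S =>
    Finset.sum_nonneg fun g _ => hw g
  by_cases hY0 : ∃ i, ∑ g ∈ y i, w g = 0
  · obtain ⟨i, hi⟩ := hY0
    rw [Finset.prod_eq_zero (mem_univ i) hi, mul_zero]
    exact Finset.prod_nonneg fun i _ => hnn _
  push Not at hY0
  have hYpos : ∀ i, 0 < ∑ g ∈ y i, w g := fun i => lt_of_le_of_ne (hnn _) (hY0 i).symm
  have : Nonempty (Fin n) := ⟨⟨0, hn⟩⟩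
  obtain ⟨i0, hi0⟩ := Finite.exists_min (fun i => ∑ g ∈ x i, w g)
  have hS : ∀ j, ∃ S : Finset (Fin m), S ⊆ x j ∧ (∀ g ∈ S, ∀ h ∈ S, g = h) ∧
      ∑ g ∈ x j \ S, w g ≤ ∑ g ∈ x i0, w g := by
    intro j
    rcases lt_or_eq_of_le (hi0 j) with h | h
    · obtain ⟨g, hg, hle⟩ := hE i0 j h
      exact ⟨{g}, by simpa using hg, by simp, by rwa [Finset.sdiff_singleton_eq_erase]⟩
    · exact ⟨∅, by simp, by simp, by simpa using h.ge⟩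
  choose S hSx hS1 hSl using hS
  have hdisj : ∀ z : Fin n → Finset (Fin m), IsAllocation z → ∀ i j g,
      g ∈ z i → g ∈ z j → i = j := fun z hz i j g h1 h2 => (hz g).unique h1 h2
  have htot : ∀ z : Fin n → Finset (Fin m), IsAllocation z →
      ∑ i, ∑ g ∈ z i, w g = ∑ g, w g := by
    intro z hz
    rw [← Finset.sum_biUnion]
    · apply Finset.sum_congr _ fun _ _ => rfl
      ext g
      obtain ⟨i, hi, _⟩ := hz g
      simp only [mem_biUnion, mem_univ, true_and, iff_true]
      exact ⟨i, hi⟩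
    · intro i _ j _ hij
      exact Finset.disjoint_left.2 fun g h1 h2 => hij (hdisj z hz i j g h1 h2)
  set l := ∑ g ∈ x i0, w g with hl
  rcases (hnn (x i0)).eq_or_lt with h0 | hlpos
  · -- some bundle of `x` is worthless, so at most `n - 1` goods are valuable
    exfalso
    rw [← hl] at h0
    have hg : ∀ i, ∃ g ∈ y i, 0 < w g := by
      intro i
      by_contra! hcon
      exact absurd (hYpos i) (not_lt.2 (Finset.sum_nonpos hcon))
    choose G hGy hGw using hg
    choose f hf _ using fun i => hx (G i)
    have hGS : ∀ i, G i ∈ S (f i) := by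
      intro i
      by_contra hcon
      have h1 : w (G i) ≤ ∑ g ∈ x (f i) \ S (f i), w g :=
        Finset.single_le_sum (f := w) (fun g _ => hw g) (mem_sdiff.2 ⟨hf i, hcon⟩)
      linarith [hSl (f i), hGw i]
    have hinj : Function.Injective f := by
      intro i j hij
      have h1 := hGS i
      rw [hij] at h1
      have h2 := hS1 _ _ h1 _ (hGS j)
      exact hdisj y hy i j (G i) (hGy i) (h2 ▸ hGy j)
    obtain ⟨i, hi⟩ := (Finite.injective_iff_surjective.1 hinj) i0
    have h3 : w (G i) ≤ ∑ g ∈ x i0, w g :=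
      Finset.single_le_sum (f := w) (fun g _ => hw g) (hi ▸ hf i)
    linarith [hGw i]
  rw [← hl] at hlpos
  have hσ : ∀ j, ∃ i, S j ⊆ y i := by
    intro j
    rcases (S j).eq_empty_or_nonempty with h | ⟨g, hg⟩
    · exact ⟨i0, by simp [h]⟩
    · obtain ⟨i, hi, _⟩ := hy g
      exact ⟨i, fun g' hg' => hS1 j g hg g' hg' ▸ hi⟩
  choose σ hσ using hσ
  have hsplit : ∀ j, ∑ g ∈ x j \ S j, w g + ∑ g ∈ S j, w g = ∑ g ∈ x j, w g :=
    fun j => Finset.sum_sdiff (hSx j)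
  have key := nsw_core hn (fun j => (∑ g ∈ S j, w g) / l) (fun j => (∑ g ∈ x j, w g) / l)
    (fun i => (∑ g ∈ y i, w g) / l) σ
    (fun j => by rw [le_div_iff₀ hlpos, one_mul]; exact hi0 j)
    (fun j => div_le_div_of_nonneg_right (by linarith [hsplit j, hnn (x j \ S j)]) hlpos.le)
    (fun j => by
      rw [div_add_one hlpos.ne']
      exact div_le_div_of_nonneg_right (by linarith [hsplit j, hSl j]) hlpos.le)
    (fun j => div_nonneg (hnn _) hlpos.le)
    (by rw [← Finset.sum_div, ← Finset.sum_div, htot x hx, htot y hy])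
    (fun i => div_pos (hYpos i) hlpos)
    (fun i => by
      rw [← Finset.sum_div]
      apply div_le_div_of_nonneg_right _ hlpos.le
      rw [← Finset.sum_biUnion]
      · apply Finset.sum_le_sum_of_subset_of_nonneg
        · intro g hg
          simp only [mem_biUnion, mem_filter, mem_univ, true_and] at hg
          obtain ⟨j, rfl, hj⟩ := hg
          exact hσ j hj
        · intro g _ _
          exact hw g
      · intro j _ k _ hjk
        exact Finset.disjoint_left.2 fun g h1 h2 =>
          hjk (hdisj x hx j k g (hSx j h1) (hSx k h2)))
  rw [Finset.prod_div_distrib, Finset.prod_div_distrib, ← mul_div_assoc] at key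
  exact (div_le_div_iff_of_pos_right (Finset.prod_pos fun _ _ => hlpos)).1 key
end
end
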